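/- arXiv:2305.18130 — 4 statements merged into one kernel-verified Lean document; each statement's English description precedes it below -/
import Mathlib

section
/- Let k ≥ 2 and s ≥ 3 be integers with s odd and s ≤ 2k-1, and let n ≥ 36288(⌊(s+1)/2⌋)^8. Then the unique graph on n vertices that is {K_{k+1}, L_s}-free and has maximum spectral radius among all such graphs is the join K_{(s-1)/2} ∨ K̄_{n-(s-1)/2} of a complete graph on (s-1)/2 vertices with an empty graph on n-(s-1)/2 vertices. -/
open SimpleGraph Matrix

/-- The adjacency matrix of a simple graph, over `ℝ`. -/
noncomputable def adjMat {V : Type*} (G : SimpleGraph V) : Matrix V V ℝ :=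
  fun a b => by classical exact if G.Adj a b then 1 else 0

/-- The spectral radius of a graph: the largest (real) eigenvalue of its adjacency
matrix, expressed as the supremum of the real spectrum. -/
noncomputable def specRad {V : Type*} [Fintype V] [DecidableEq V] (G : SimpleGraph V) : ℝ :=
  sSup (spectrum ℝ (adjMat G))

/-- A linear forest: an acyclic graph in which every vertex has degree at most 2,
i.e. every connected component is a path. -/
def IsLinearForest {V : Type*} (H : SimpleGraph V) : Prop :=
  H.IsAcyclic ∧ ∀ v, {w | H.Adj v w}.ncard ≤ 2

/-- `G` contains some member of `𝓛 s`, the family of linear forests with `s` edges. -/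
def ContainsLinForest {V : Type*} (G : SimpleGraph V) (s : ℕ) : Prop :=
  ∃ H : SimpleGraph V, H ≤ G ∧ IsLinearForest H ∧ H.edgeSet.ncard = s

/-- `G` belongs to `Ex_sp(n, {K_{k+1}, 𝓛_s})`: it is `{K_{k+1}, 𝓛_s}`-free and has the
maximum spectral radius among all such graphs on `n` vertices. -/
def IsExtremal (n k s : ℕ) (G : SimpleGraph (Fin n)) : Prop :=
  G.CliqueFree (k + 1) ∧ ¬ ContainsLinForest G s ∧
    ∀ H : SimpleGraph (Fin n), H.CliqueFree (k + 1) → ¬ ContainsLinForest H s →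
      specRad H ≤ specRad G

/-- The degree of `v` in `G`. -/
noncomputable def degOf {V : Type*} (G : SimpleGraph V) (v : V) : ℕ :=
  {w | G.Adj v w}.ncard

/-- `K_a ∨ K̄_{n-a}` on `Fin n`: the first `a` vertices form a clique joined to all others. -/
def cliqueJoinEmpty (n a : ℕ) : SimpleGraph (Fin n) :=
  SimpleGraph.fromRel (fun u _ => u.val < a)


/-- Join of a clique on `S` with the empty graph on the complement. -/
def joinOn {V : Type*} (S : Finset V) : SimpleGraph V where
  Adj u v := u ≠ v ∧ (u ∈ S ∨ v ∈ S)
  symm := ⟨fun _ _ h => ⟨h.1.symm, h.2.symm⟩⟩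
  loopless := ⟨fun _ h => h.1 rfl⟩

theorem linForest_add_edge {V : Type*} [Finite V] {H : SimpleGraph V} (hH : IsLinearForest H)
    {u v : V} (huv : u ≠ v) (hv : ∀ w, ¬ H.Adj v w) (hu : {w | H.Adj u w}.ncard ≤ 1) :
    IsLinearForest (H ⊔ edge u v) ∧ (H ⊔ edge u v).edgeSet.ncard = H.edgeSet.ncard + 1 := by
  refine ⟨⟨?_, ?_⟩, ?_⟩
  · refine hH.1.sup_edge_of_not_reachable ?_
    intro hr
    obtain ⟨p⟩ := hr.symm
    cases p with
    | nil => exact huv rfl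
    | cons h _ => exact hv _ h
  · intro x
    by_cases hxu : x = u
    · subst hxu
      have : {w | (H ⊔ edge x v).Adj x w} ⊆ insert v {w | H.Adj x w} := by
        intro w hw
        simp only [Set.mem_ofPred_eq, sup_adj, edge_adj, Set.mem_insert_iff] at hw ⊢
        tauto
      refine (Set.ncard_le_ncard this (Set.toFinite _)).trans ((Set.ncard_insert_le _ _).trans ?_)
      omega
    · by_cases hxv : x = v
      · subst hxv
        have : {w | (H ⊔ edge u x).Adj x w} ⊆ {u} := by
          intro w hw
          simp only [Set.mem_ofPred_eq, sup_adj, edge_adj, Set.mem_singleton_iff] at hw ⊢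
          have := hv w
          tauto
        refine (Set.ncard_le_ncard this (Set.toFinite _)).trans ?_
        simp
      · have : {w | (H ⊔ edge u v).Adj x w} ⊆ {w | H.Adj x w} := by
          intro w hw
          simp only [Set.mem_ofPred_eq, sup_adj, edge_adj] at hw ⊢
          tauto
        exact (Set.ncard_le_ncard this (Set.toFinite _)).trans (hH.2 x)
  · rw [edgeSet_sup, edgeSet_edge_of_ne huv, Set.union_singleton, Set.ncard_insert_of_notMem]
    intro h
    exact hv u (SimpleGraph.Adj.symm (by simpa using h))

theorem linForest_bot {V : Type*} : IsLinearForest (⊥ : SimpleGraph V) :=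
  ⟨isAcyclic_bot, by simp⟩

/-- Greedy construction of a linear forest: an edge plus disjoint cherries. -/
theorem greedy {V : Type*} [Fintype V] [DecidableEq V] (G : SimpleGraph V) (A : Finset V)
    (hA : ∀ v ∈ A, 4 * A.card + 5 ≤ {w | G.Adj v w}.ncard) {u w : V} (huw : G.Adj u w)
    (hu : u ∉ A) (hw : w ∉ A) (T : Finset V) : T ⊆ A →
    ∃ (H : SimpleGraph V) (W : Finset V), H ≤ G ∧ IsLinearForest H ∧
      H.edgeSet.ncard = 2 * T.card + 1 ∧ (∀ x y, H.Adj x y → x ∈ W) ∧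
      W.card ≤ 3 * T.card + 2 ∧ (∀ x ∈ A, x ∉ T → x ∉ W) := by
  induction T using Finset.induction_on with
  | empty =>
    intro _
    obtain ⟨h1, h2⟩ := linForest_add_edge (linForest_bot (V := V)) huw.ne (by simp) (by simp)
    refine ⟨⊥ ⊔ edge u w, {u, w}, ?_, h1, ?_, ?_, ?_, ?_⟩
    · rw [bot_sup_eq]
      exact (edge_le_iff _).2 (Or.inr huw)
    · simpa using h2
    · intro x y h
      simp only [sup_adj, bot_adj, edge_adj, false_or] at h
      simp only [Finset.mem_insert, Finset.mem_singleton]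
      tauto
    · exact Finset.card_le_two.trans (by simp)
    · intro x hx _ h
      simp only [Finset.mem_insert, Finset.mem_singleton] at h
      rcases h with rfl | rfl <;> contradiction
  | insert v T hvT ih =>
    intro hTA
    have hvA : v ∈ A := hTA (Finset.mem_insert_self _ _)
    obtain ⟨H, W, hHG, hH, hcard, hsup, hW, hAW⟩ :=
      ih (fun x hx => hTA (Finset.mem_insert_of_mem hx))
    have hTc : T.card + 1 ≤ A.card := by
      rw [← Finset.card_insert_of_notMem hvT]; exact Finset.card_le_card hTA
    have hvW : v ∉ W := hAW v hvA hvT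
    classical
    let N : Finset V := Finset.univ.filter (fun y => G.Adj v y)
    have hN : {y | G.Adj v y}.ncard = N.card := by
      rw [← Set.ncard_coe_finset]; congr 1; ext; simp [N]
    have hd := hA v hvA
    rw [hN] at hd
    have h2 : 1 < (N \ (W ∪ A)).card := by
      have h3 := Finset.le_card_sdiff (W ∪ A) N
      have h4 := Finset.card_union_le W A
      omega
    obtain ⟨x, hx, y, hy, hxy⟩ := Finset.one_lt_card.1 h2
    simp only [Finset.mem_sdiff, Finset.mem_union, not_or, N, Finset.mem_filter,
      Finset.mem_univ, true_and] at hx hy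
    have iso : ∀ z, z ∉ W → ∀ t, ¬ H.Adj z t := fun z hz t h => hz (hsup z t h)
    have e0 : {w | H.Adj v w} = ∅ := by
      ext t; simpa using iso v hvW t
    obtain ⟨a1, a2⟩ := linForest_add_edge hH hx.1.ne (iso x hx.2.1) (by rw [e0]; simp)
    obtain ⟨b1, b2⟩ := linForest_add_edge (u := v) (v := y) a1 hy.1.ne (by
        intro t h
        simp only [sup_adj, edge_adj] at h
        have := iso y hy.2.1 t
        have := hy.1.ne
        tauto) (by
        have : {w | (H ⊔ edge v x).Adj v w} ⊆ {x} := by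
          intro t ht
          simp only [Set.mem_ofPred_eq, sup_adj, edge_adj, Set.mem_singleton_iff] at ht ⊢
          have := iso v hvW t
          have := hx.1.ne
          tauto
        exact (Set.ncard_le_ncard this (Set.toFinite _)).trans (by simp))
    refine ⟨H ⊔ edge v x ⊔ edge v y, insert v (insert x (insert y W)), ?_, b1, ?_, ?_, ?_, ?_⟩
    · exact sup_le (sup_le hHG ((edge_le_iff _).2 (Or.inr hx.1))) ((edge_le_iff _).2 (Or.inr hy.1))
    · rw [b2, a2, hcard, Finset.card_insert_of_notMem hvT]; ring
    · intro p q h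
      simp only [sup_adj, edge_adj] at h
      simp only [Finset.mem_insert]
      have := hsup p q
      tauto
    · rw [Finset.card_insert_of_notMem hvT]
      have c1 := Finset.card_insert_le v (insert x (insert y W))
      have c2 := Finset.card_insert_le x (insert y W)
      have c3 := Finset.card_insert_le y W
      omega
    · intro z hz hzT h
      simp only [Finset.mem_insert, not_or] at hzT h
      rcases h with rfl | rfl | rfl | h
      · exact hzT.1 rfl
      · exact hx.2.2 hz
      · exact hy.2.2 hz
      · exact hAW z hz hzT.2 h

theorem le_joinOn_of_free {V : Type*} [Fintype V] [DecidableEq V] (G : SimpleGraph V)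
    (A : Finset V) (hA : ∀ v ∈ A, 4 * A.card + 5 ≤ {w | G.Adj v w}.ncard)
    (hG : ¬ ContainsLinForest G (2 * A.card + 1)) : G ≤ joinOn A := by
  intro u w huw
  refine ⟨huw.ne, ?_⟩
  by_contra h
  rw [not_or] at h
  obtain ⟨H, W, h1, h2, h3, _⟩ := greedy G A hA huw h.1 h.2 A subset_rfl
  exact hG ⟨H, h1, h2, h3⟩

theorem joinOn_free {V : Type*} [Fintype V] (S : Finset V) (s : ℕ)
    (hs : 2 * S.card < s) : ¬ ContainsLinForest (joinOn S) s := by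
  rintro ⟨H, hle, hH, hc⟩
  have hsub : H.edgeSet ⊆ ⋃ v ∈ S, (fun w => s(v, w)) '' {w | H.Adj v w} := by
    intro e he
    induction e using Sym2.ind with
    | _ x y =>
      have hxy : H.Adj x y := by simpa using he
      simp only [Set.mem_iUnion, Set.mem_image, Set.mem_ofPred_eq]
      rcases (hle hxy).2 with h | h
      · exact ⟨x, h, y, hxy, rfl⟩
      · exact ⟨y, h, x, hxy.symm, Sym2.eq_swap⟩
  have h1 := Set.ncard_le_ncard hsub (Set.toFinite _)
  have h2 := S.set_ncard_biUnion_le (fun v => (fun w => s(v, w)) '' {w | H.Adj v w})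
  have h3 : ∑ v ∈ S, ((fun w => s(v, w)) '' {w | H.Adj v w}).ncard ≤ ∑ v ∈ S, 2 :=
    Finset.sum_le_sum fun v _ => (Set.ncard_image_le (Set.toFinite _)).trans (hH.2 v)
  rw [Finset.sum_const, smul_eq_mul] at h3
  omega

theorem joinOn_cliqueFree {V : Type*} [DecidableEq V] (S : Finset V) (k : ℕ)
    (hk : S.card + 1 ≤ k) : (joinOn S).CliqueFree (k + 1) := by
  intro t ht
  have h1 := Finset.le_card_sdiff S t
  rw [ht.card_eq] at h1
  obtain ⟨x, hx, y, hy, hxy⟩ := Finset.one_lt_card.1 (show 1 < (t \ S).card by omega)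
  rw [Finset.mem_sdiff] at hx hy
  have := (ht.isClique hx.1 hy.1 hxy).2
  tauto

theorem cliqueJoinEmpty_eq (n a : ℕ) :
    cliqueJoinEmpty n a = joinOn (Finset.univ.filter (fun v : Fin n => v.val < a)) := by
  ext u v
  simp [cliqueJoinEmpty, joinOn]

theorem card_filter_lt (n a : ℕ) (h : a ≤ n) :
    (Finset.univ.filter (fun v : Fin n => v.val < a)).card = a := by
  rw [Fin.card_filter_val_lt]; omega

theorem joinOn_iso {V : Type*} [Fintype V] [DecidableEq V] (S T : Finset V)
    (h : S.card = T.card) : Nonempty (joinOn S ≃g joinOn T) := by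
  have e : {x // x ∈ S} ≃ {x // x ∈ T} := Finset.equivOfCardEq h
  have he : ∀ x, e.extendSubtype x ∈ T ↔ x ∈ S := by
    intro x
    constructor
    · intro hx
      by_contra hn
      exact e.extendSubtype_not_mem x hn hx
    · exact e.extendSubtype_mem x
  exact ⟨⟨e.extendSubtype, by intro a b; simp [joinOn, he]⟩⟩

theorem eq_joinOn_of_iso {V : Type*} [Fintype V] [DecidableEq V] (G : SimpleGraph V) (S : Finset V)
    (e : G ≃g joinOn S) : ∃ T : Finset V, T.card = S.card ∧ G = joinOn T := by
  refine ⟨S.map e.symm.toEquiv.toEmbedding, by simp, ?_⟩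
  ext u v
  rw [← e.map_adj_iff]
  have : ∀ x, x ∈ S.map e.symm.toEquiv.toEmbedding ↔ e x ∈ S := by
    intro x
    rw [Finset.mem_map_equiv]
    rfl
  exact and_congr e.injective.ne_iff (or_congr (this u).symm (this v).symm)

theorem adjMat_apply {V : Type*} (G : SimpleGraph V) [DecidableRel G.Adj] (u v : V) :
    adjMat G u v = if G.Adj u v then 1 else 0 := by
  unfold adjMat; congr

theorem adjMat_nonneg {V : Type*} (G : SimpleGraph V) (u v : V) : 0 ≤ adjMat G u v := by
  classical
  rw [adjMat_apply]; split_ifs <;> norm_num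

theorem adjMat_le_one {V : Type*} (G : SimpleGraph V) (u v : V) : adjMat G u v ≤ 1 := by
  classical
  rw [adjMat_apply]; split_ifs <;> norm_num

theorem adjMat_symm {V : Type*} (G : SimpleGraph V) (u v : V) : adjMat G u v = adjMat G v u := by
  classical
  simp only [adjMat_apply, G.adj_comm]

theorem adjMat_mono {V : Type*} {G H : SimpleGraph V} (h : G ≤ H) (u v : V) :
    adjMat G u v ≤ adjMat H u v := by
  classical
  rw [adjMat_apply, adjMat_apply]
  by_cases h1 : G.Adj u v
  · simp [h1, h h1]
  · simp only [h1, if_false]; split_ifs <;> norm_num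

theorem mem_spec_iff {V : Type*} [Fintype V] [DecidableEq V] (M : Matrix V V ℝ) (μ : ℝ) :
    μ ∈ spectrum ℝ M ↔ ∃ x : V → ℝ, x ≠ 0 ∧ M *ᵥ x = μ • x := by
  rw [← Matrix.spectrum_toLin', ← Module.End.hasEigenvalue_iff_mem_spectrum]
  constructor
  · intro h
    obtain ⟨x, hx⟩ := h.exists_hasEigenvector
    exact ⟨x, hx.2, by simpa using hx.apply_eq_smul⟩
  · rintro ⟨x, h0, hx⟩
    exact Module.End.hasEigenvalue_of_hasEigenvector
      (x := x) ⟨Module.End.mem_eigenspace_iff.2 (by simpa using hx), h0⟩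

theorem spec_vec {V : Type*} [Fintype V] [DecidableEq V] (G : SimpleGraph V) (μ : ℝ)
    (h : μ ∈ spectrum ℝ (adjMat G)) :
    ∃ y : V → ℝ, (∀ v, 0 ≤ y v) ∧ (∃ v, 0 < y v) ∧
      ∀ v, μ * y v ≤ ∑ w, adjMat G v w * y w := by
  obtain ⟨x, hx0, hx⟩ := (mem_spec_iff _ _).1 h
  refine ⟨fun v => |x v|, fun v => abs_nonneg _, ?_, ?_⟩
  · obtain ⟨v, hv⟩ := Function.ne_iff.1 hx0
    exact ⟨v, abs_pos.2 hv⟩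
  · intro v
    have h1 : ∑ w, adjMat G v w * x w = μ * x v := congrFun hx v
    calc μ * |x v| ≤ |μ| * |x v| := by gcongr; exact le_abs_self _
      _ = |∑ w, adjMat G v w * x w| := by rw [h1, abs_mul]
      _ ≤ ∑ w, |adjMat G v w * x w| := Finset.abs_sum_le_sum_abs _ _
      _ = _ := by
        refine Finset.sum_congr rfl fun w _ => ?_
        rw [abs_mul, abs_of_nonneg (adjMat_nonneg G v w)]

theorem specRad_mem {V : Type*} [Fintype V] [DecidableEq V] [Nonempty V] (G : SimpleGraph V) :
    specRad G ∈ spectrum ℝ (adjMat G) ∧ ∀ μ ∈ spectrum ℝ (adjMat G), μ ≤ specRad G := by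
  have hH : (adjMat G).IsHermitian := by
    ext u v
    simp [adjMat_symm G u v]
  have hr := hH.spectrum_real_eq_range_eigenvalues
  have hfin : (spectrum ℝ (adjMat G)).Finite := by rw [hr]; exact Set.finite_range _
  have hne : (spectrum ℝ (adjMat G)).Nonempty := by rw [hr]; exact Set.range_nonempty _
  exact ⟨hne.csSup_mem hfin, fun μ hμ => le_csSup hfin.bddAbove hμ⟩

/-- The Perron vector of `joinOn S`. -/
noncomputable def pvec {V : Type*} (S : Finset V) (l : ℝ) : V → ℝ :=
  fun v => by classical exact if v ∈ S then l else S.card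

theorem pvec_eigen {V : Type*} [Fintype V] [DecidableEq V] (S : Finset V) (l : ℝ)
    (hl : l ^ 2 = (S.card - 1) * l + S.card * (Fintype.card V - S.card)) (v : V) :
    ∑ w, adjMat (joinOn S) v w * pvec S l w = l * pvec S l v := by
  classical
  have hp : ∀ w, pvec S l w = if w ∈ S then l else (S.card : ℝ) := by
    intro w; unfold pvec; congr
  have key : ∀ w, adjMat (joinOn S) v w * pvec S l w =
      if v ∈ S then ((if w ∈ S then l else (S.card : ℝ)) - if w = v then l else 0)
      else (if w ∈ S then l else 0) := by
    intro w
    rw [adjMat_apply, hp]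
    simp only [joinOn]
    by_cases hv : v ∈ S <;> by_cases hw : w ∈ S <;> by_cases hvw : w = v
    all_goals first | subst hvw | skip
    all_goals simp_all [eq_comm]
  rw [Finset.sum_congr rfl fun w _ => key w, hp]
  have s1 : ∑ w, (if w ∈ S then l else (0 : ℝ)) = S.card * l := by simp
  have s2 : ∑ w, (if w ∈ S then l else (S.card : ℝ)) =
      S.card * l + (Fintype.card V - S.card) * S.card := by
    have : ∀ w, (if w ∈ S then l else (S.card : ℝ)) =
        S.card + (if w ∈ S then l - S.card else 0) := by
      intro w; split_ifs <;> ring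
    rw [Finset.sum_congr rfl fun w _ => this w, Finset.sum_add_distrib]
    simp
    ring
  by_cases hv : v ∈ S
  · simp only [hv, if_true, Finset.sum_sub_distrib, s2]
    simp
    linarith
  · simp only [hv, if_false, s1]
    ring

theorem pvec_pos {V : Type*} (S : Finset V) (l : ℝ) (hl : 0 < l) (hS : 0 < S.card) (v : V) :
    0 < pvec S l v := by
  unfold pvec
  split_ifs
  · exact hl
  · exact_mod_cast hS

theorem joinOn_mem_spec {V : Type*} [Fintype V] [DecidableEq V] [Nonempty V] (S : Finset V) (l : ℝ)
    (hl : l ^ 2 = (S.card - 1) * l + S.card * (Fintype.card V - S.card))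
    (hl0 : 0 < l) (hS : 0 < S.card) : l ∈ spectrum ℝ (adjMat (joinOn S)) := by
  refine (mem_spec_iff _ _).2 ⟨pvec S l, ?_, ?_⟩
  · intro h
    obtain ⟨v⟩ := ‹Nonempty V›
    have := pvec_pos S l hl0 hS v
    rw [h] at this
    exact lt_irrefl _ this
  · ext v
    exact pvec_eigen S l hl v

/-- Spectral comparison for spanning subgraphs of `joinOn S`. -/
theorem compare {V : Type*} [Fintype V] [DecidableEq V] (S : Finset V) (l : ℝ)
    (hl : l ^ 2 = (S.card - 1) * l + S.card * (Fintype.card V - S.card))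
    (hl0 : 0 < l) (hS : 0 < S.card) (G : SimpleGraph V) (hG : G ≤ joinOn S) (μ : ℝ)
    (hμ : μ ∈ spectrum ℝ (adjMat G)) (hlμ : l ≤ μ) : G = joinOn S ∧ μ = l := by
  classical
  obtain ⟨y, hy0, ⟨v0, hv0⟩, hy⟩ := spec_vec G μ hμ
  set p := pvec S l with hp
  have hpp : ∀ v, 0 < p v := pvec_pos S l hl0 hS
  set K := joinOn S with hK
  have hterm : ∀ v w, adjMat G v w * y w ≤ adjMat K v w * y w := fun v w =>
    mul_le_mul_of_nonneg_right (adjMat_mono hG v w) (hy0 w)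
  have hGK : ∀ v, ∑ w, adjMat G v w * y w ≤ ∑ w, adjMat K v w * y w := fun v =>
    Finset.sum_le_sum fun w _ => hterm v w
  have hly : ∀ v, l * y v ≤ μ * y v := fun v => mul_le_mul_of_nonneg_right hlμ (hy0 v)
  have hnn : ∀ v, 0 ≤ p v * ((∑ w, adjMat K v w * y w) - l * y v) := fun v =>
    mul_nonneg (hpp v).le (by linarith [hGK v, hy v, hly v])
  have hsum : ∑ v, p v * ((∑ w, adjMat K v w * y w) - l * y v) = 0 := by
    have h1 : ∑ v, p v * (∑ w, adjMat K v w * y w) = ∑ w, y w * ∑ v, adjMat K w v * p v := by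
      simp only [Finset.mul_sum]
      rw [Finset.sum_comm]
      refine Finset.sum_congr rfl fun w _ => Finset.sum_congr rfl fun v _ => ?_
      rw [adjMat_symm K v w]; ring
    simp only [mul_sub, Finset.sum_sub_distrib]
    rw [h1, ← Finset.sum_sub_distrib]
    refine Finset.sum_eq_zero fun w _ => ?_
    rw [pvec_eigen S l hl w]; ring
  have hz : ∀ v, ∑ w, adjMat K v w * y w = l * y v := by
    intro v
    have := (Finset.sum_eq_zero_iff_of_nonneg fun v _ => hnn v).1 hsum v (Finset.mem_univ v)
    rcases mul_eq_zero.1 this with h | h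
    · exact absurd h (hpp v).ne'
    · linarith
  have hμl : μ = l := by
    have h1 := hy v0
    have h2 := hGK v0
    rw [hz] at h2
    exact le_antisymm (le_of_mul_le_mul_right (h1.trans h2) hv0) hlμ
  refine ⟨?_, hμl⟩
  have hGe : ∀ v w, adjMat G v w * y w = adjMat K v w * y w := by
    intro v w
    have h1 : ∑ w, adjMat G v w * y w = ∑ w, adjMat K v w * y w :=
      le_antisymm (hGK v) (by rw [hz v, ← hμl]; exact hy v)
    exact (Finset.sum_eq_sum_iff_of_le fun w _ => hterm v w).1 h1 w (Finset.mem_univ w)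
  -- if `u ∈ S` has `y u = 0` then `y = 0`
  have hS0 : ∀ u ∈ S, y u ≠ 0 := by
    intro u hu h
    have h1 := hz u
    rw [h, mul_zero] at h1
    have h2 := (Finset.sum_eq_zero_iff_of_nonneg
      fun w _ => mul_nonneg (adjMat_nonneg K u w) (hy0 w)).1 h1 v0 (Finset.mem_univ v0)
    by_cases huv : u = v0
    · subst huv; exact hv0.ne' h
    · have : K.Adj u v0 := ⟨huv, Or.inl hu⟩
      rw [adjMat_apply, if_pos this, one_mul] at h2
      exact hv0.ne' h2
  have hadj : ∀ u v, u ∈ S → K.Adj v u → G.Adj v u := by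
    intro u v hu h
    by_contra hn
    have := hGe v u
    rw [adjMat_apply, adjMat_apply, if_pos h, if_neg hn] at this
    exact hS0 u hu (by linarith)
  refine le_antisymm hG ?_
  intro u v huv
  rcases huv.2 with h | h
  · exact (hadj u v h huv.symm).symm
  · exact hadj v u h huv

theorem specRad_joinOn {V : Type*} [Fintype V] [DecidableEq V] [Nonempty V] (S : Finset V) (l : ℝ)
    (hl : l ^ 2 = (S.card - 1) * l + S.card * (Fintype.card V - S.card))
    (hl0 : 0 < l) (hS : 0 < S.card) : specRad (joinOn S) = l := by
  obtain ⟨h1, h2⟩ := specRad_mem (joinOn S)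
  have h3 := h2 l (joinOn_mem_spec S l hl hl0 hS)
  exact (compare S l hl hl0 hS _ le_rfl _ h1 h3).2

/-- Upper bound for eigenvalues when there are few vertices of large degree. -/
theorem eig_bound {V : Type*} [Fintype V] [DecidableEq V] (G : SimpleGraph V) (A : Finset V)
    (D : ℝ) (hD : ∀ v, v ∉ A → ({w | G.Adj v w}.ncard : ℝ) ≤ D) (μ : ℝ)
    (hμ : μ ∈ spectrum ℝ (adjMat G)) (h1 : D < μ) (h2 : (A.card : ℝ) < μ) :
    (μ - D) * (μ - A.card) ≤ A.card * Fintype.card V := by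
  classical
  obtain ⟨y, hy0, ⟨v0, hv0⟩, hy⟩ := spec_vec G μ hμ
  haveI : Nonempty V := ⟨v0⟩
  obtain ⟨a, ha⟩ := Finite.exists_max (fun v => if v ∈ A then y v else 0)
  obtain ⟨b, hb⟩ := Finite.exists_max (fun v => if v ∈ A then 0 else y v)
  set M : ℝ := if a ∈ A then y a else 0 with hM
  set m : ℝ := if b ∈ A then 0 else y b with hm
  have hMA : ∀ v ∈ A, y v ≤ M := fun v hv => by simpa [hv] using ha v
  have hmB : ∀ v, v ∉ A → y v ≤ m := fun v hv => by simpa [hv] using hb v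
  have hM0 : 0 ≤ M := by rw [hM]; split_ifs; exacts [hy0 a, le_rfl]
  have hm0 : 0 ≤ m := by rw [hm]; split_ifs; exacts [le_rfl, hy0 b]
  have hsplit : ∀ v, ∑ w, adjMat G v w * y w =
      ∑ w ∈ A, adjMat G v w * y w + ∑ w ∈ Aᶜ, adjMat G v w * y w := fun v =>
    (Finset.sum_add_sum_compl A _).symm
  have hA1 : ∀ v, ∑ w ∈ A, adjMat G v w * y w ≤ A.card * M := by
    intro v
    rw [← nsmul_eq_mul]
    refine Finset.sum_le_card_nsmul _ _ _ fun w hw => ?_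
    exact (mul_le_of_le_one_left (hy0 w) (adjMat_le_one G v w)).trans (hMA w hw)
  have hB1 : ∀ v, ∑ w ∈ Aᶜ, adjMat G v w * y w ≤ Fintype.card V * m := by
    intro v
    have : ∑ w ∈ Aᶜ, adjMat G v w * y w ≤ (Aᶜ.card : ℝ) * m := by
      rw [← nsmul_eq_mul]
      refine Finset.sum_le_card_nsmul _ _ _ fun w hw => ?_
      exact (mul_le_of_le_one_left (hy0 w) (adjMat_le_one G v w)).trans
        (hmB w (Finset.mem_compl.1 hw))
    refine this.trans (mul_le_mul_of_nonneg_right ?_ hm0)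
    exact_mod_cast Finset.card_le_univ _
  have hB2 : ∀ v, v ∉ A → ∑ w ∈ Aᶜ, adjMat G v w * y w ≤ D * m := by
    intro v hv
    calc ∑ w ∈ Aᶜ, adjMat G v w * y w ≤ ∑ w ∈ Aᶜ, adjMat G v w * m :=
          Finset.sum_le_sum fun w hw => mul_le_mul_of_nonneg_left
            (hmB w (Finset.mem_compl.1 hw)) (adjMat_nonneg G v w)
      _ ≤ ∑ w, adjMat G v w * m := Finset.sum_le_univ_sum_of_nonneg
          fun w => mul_nonneg (adjMat_nonneg G v w) hm0
      _ = ({w | G.Adj v w}.ncard : ℝ) * m := by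
          rw [← Finset.sum_mul]
          congr 1
          have : {w | G.Adj v w}.ncard = (Finset.univ.filter (fun w => G.Adj v w)).card := by
            rw [← Set.ncard_coe_finset]; congr 1; ext; simp
          rw [this]
          simp [adjMat_apply]
      _ ≤ D * m := mul_le_mul_of_nonneg_right (hD v hv) hm0
  have e1 : (μ - A.card) * M ≤ Fintype.card V * m := by
    by_cases haA : a ∈ A
    · have hMe : M = y a := by rw [hM, if_pos haA]
      have := hy a
      rw [hsplit, ← hMe] at this
      linarith [hA1 a, hB1 a]
    · have hMe : M = 0 := by rw [hM, if_neg haA]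
      rw [hMe, mul_zero]; positivity
  have e2 : (μ - D) * m ≤ A.card * M := by
    by_cases hbA : b ∈ A
    · have hme : m = 0 := by rw [hm, if_pos hbA]
      rw [hme, mul_zero]; positivity
    · have hme : m = y b := by rw [hm, if_neg hbA]
      have := hy b
      rw [hsplit, ← hme] at this
      linarith [hA1 b, hB2 b hbA]
  have hMpos : 0 < M := by
    by_contra hcon
    have hMz : M = 0 := le_antisymm (not_lt.1 hcon) hM0
    rw [hMz, mul_zero] at e2
    have hmz : m ≤ 0 := by
      by_contra hc
      have := mul_pos (sub_pos.2 h1) (not_le.1 hc)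
      linarith
    by_cases hv : v0 ∈ A
    · linarith [hMA v0 hv]
    · linarith [hmB v0 hv]
  have e3 : (μ - D) * ((μ - A.card) * M) ≤ (μ - D) * (Fintype.card V * m) :=
    mul_le_mul_of_nonneg_left e1 (sub_pos.2 h1).le
  have e4 : (Fintype.card V : ℝ) * ((μ - D) * m) ≤ Fintype.card V * (A.card * M) :=
    mul_le_mul_of_nonneg_left e2 (by positivity)
  refine le_of_mul_le_mul_right ?_ hMpos
  linarith

theorem exists_root (a n : ℝ) (ha : 1 ≤ a) (hn : 36288 * (a + 1) ^ 8 ≤ n) :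
    ∃ l : ℝ, 0 < l ∧ l ^ 2 = (a - 1) * l + a * (n - a) := by
  have h8 : a + 1 ≤ (a + 1) ^ 8 := le_self_pow₀ (by linarith) (by norm_num)
  have hna : 0 < n - a := by nlinarith
  have hd : 0 < (a - 1) ^ 2 + 4 * (a * (n - a)) := by positivity
  refine ⟨((a - 1) + √((a - 1) ^ 2 + 4 * (a * (n - a)))) / 2, ?_, ?_⟩
  · have := Real.sqrt_pos.2 hd
    linarith
  · have := Real.sq_sqrt hd.le
    nlinarith

theorem numeric (a n l μ t : ℝ) (ha : 1 ≤ a) (hn : 36288 * (a + 1) ^ 8 ≤ n) (hl0 : 0 < l)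
    (hl : l ^ 2 = (a - 1) * l + a * (n - a)) (hlμ : l ≤ μ) (ht : t ≤ a - 1) :
    (4 * a + 5 < μ ∧ t < μ) ∧ ¬ ((μ - (4 * a + 5)) * (μ - t) ≤ t * n) := by
  have h3 : (a + 1) ^ 3 ≤ (a + 1) ^ 8 := pow_le_pow_right₀ (by linarith) (by norm_num)
  have hn3 : 36288 * (a + 1) ^ 3 ≤ n := by linarith
  have ha3 : 1 ≤ a ^ 3 := one_le_pow₀ ha
  have ha2 : 1 ≤ a ^ 2 := one_le_pow₀ ha
  have hn4 : 36288 * a ^ 3 < n := by nlinarith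
  have hn5 : 1000 * a ^ 2 + 2 * a ≤ n := by nlinarith
  have hlb : 4 * a + 5 < l := by
    by_contra hc
    push Not at hc
    have h9 : l ≤ 9 * a := by linarith
    have : l ^ 2 ≤ (9 * a) ^ 2 := by gcongr
    have : 0 ≤ (a - 1) * l := by apply mul_nonneg <;> linarith
    nlinarith
  refine ⟨⟨by linarith, by linarith⟩, ?_⟩
  intro h
  have hn0 : 0 ≤ n := by nlinarith
  have q1 : t * n ≤ (a - 1) * n := mul_le_mul_of_nonneg_right ht hn0
  have q2 : (l - (4 * a + 5)) * (l - a) ≤ (μ - (4 * a + 5)) * (μ - t) := by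
    apply mul_le_mul <;> linarith
  have q3 : n ≤ 10 * a * l := by nlinarith
  have q4 : l * l ≤ (11 * a ^ 2) * l := by
    have : a * n ≤ a * (10 * a * l) := mul_le_mul_of_nonneg_left q3 (by linarith)
    have : a * l ≤ a ^ 2 * l := by
      apply mul_le_mul_of_nonneg_right _ hl0.le; nlinarith
    nlinarith
  have q5 : l ≤ 11 * a ^ 2 := le_of_mul_le_mul_right q4 hl0
  have q6 : 10 * a * l ≤ 10 * a * (11 * a ^ 2) := mul_le_mul_of_nonneg_left q5 (by linarith)
  nlinarith

theorem main_struct {V : Type*} [Fintype V] [DecidableEq V] (a : ℕ) (ha : 1 ≤ a)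
    (hn : 36288 * ((a : ℝ) + 1) ^ 8 ≤ Fintype.card V) (l : ℝ) (hl0 : 0 < l)
    (hl : l ^ 2 = ((a : ℝ) - 1) * l + a * (Fintype.card V - a)) (G : SimpleGraph V)
    (hG : ¬ ContainsLinForest G (2 * a + 1)) (μ : ℝ) (hμ : μ ∈ spectrum ℝ (adjMat G))
    (hlμ : l ≤ μ) : ∃ S : Finset V, S.card = a ∧ G = joinOn S := by
  classical
  let A : Finset V := Finset.univ.filter (fun v => 4 * a + 5 ≤ {w | G.Adj v w}.ncard)
  have ha' : (1 : ℝ) ≤ a := by exact_mod_cast ha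
  by_cases hA : a ≤ A.card
  · obtain ⟨S, hSA, hS⟩ := Finset.exists_subset_card_eq hA
    refine ⟨S, hS, ?_⟩
    have hle : G ≤ joinOn S := by
      refine le_joinOn_of_free G S ?_ (by rw [hS]; exact hG)
      intro v hv
      rw [hS]
      exact (Finset.mem_filter.1 (hSA hv)).2
    exact (compare S l (by rw [hS]; exact hl) hl0 (by omega) G hle μ hμ hlμ).1
  · exfalso
    have hA1 : (A.card : ℝ) ≤ a - 1 := by
      have : A.card + 1 ≤ a := by omega
      have : (A.card : ℝ) + 1 ≤ a := by exact_mod_cast this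
      linarith
    obtain ⟨⟨n1, n2⟩, n3⟩ := numeric a (Fintype.card V) l μ A.card ha' hn hl0 hl hlμ hA1
    refine n3 (eig_bound G A (4 * a + 5) ?_ μ hμ n1 n2)
    intro v hv
    have : {w | G.Adj v w}.ncard ≤ 4 * a + 5 := by
      by_contra hc
      exact hv (Finset.mem_filter.2 ⟨Finset.mem_univ _, by omega⟩)
    exact_mod_cast this

/-- For `k ≥ 2`, `s ≥ 3` odd with `s ≤ 2k - 1` and `n ≥ 36288 ⌊(s+1)/2⌋⁸`, the unique
`{K_{k+1}, 𝓛_s}`-free graph on `n` vertices of maximum spectral radius is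
`K_{(s-1)/2} ∨ K̄_{n-(s-1)/2}`. -/
theorem spectral_extremal_odd_small (k s n : ℕ) (hk : 2 ≤ k) (hs : 3 ≤ s) (hodd : Odd s)
    (hsk : s ≤ 2 * k - 1) (hn : 36288 * ((s + 1) / 2) ^ 8 ≤ n) (G : SimpleGraph (Fin n)) :
    IsExtremal n k s G ↔ Nonempty (G ≃g cliqueJoinEmpty n ((s - 1) / 2)) := by
  obtain ⟨a, rfl⟩ := hodd
  have e1 : (2 * a + 1 + 1) / 2 = a + 1 := by omega
  have e2 : (2 * a + 1 - 1) / 2 = a := by omega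
  rw [e1] at hn
  rw [e2, cliqueJoinEmpty_eq]
  have ha : 1 ≤ a := by omega
  have han : a + 1 ≤ n := by
    have : a + 1 ≤ (a + 1) ^ 8 := Nat.le_self_pow (by norm_num) _
    omega
  haveI : Nonempty (Fin n) := ⟨⟨0, by omega⟩⟩
  have hnR : 36288 * ((a : ℝ) + 1) ^ 8 ≤ (Fintype.card (Fin n) : ℝ) := by
    rw [Fintype.card_fin]; exact_mod_cast hn
  obtain ⟨l, hl0, hl⟩ := exists_root a _ (by exact_mod_cast ha) hnR
  have hS0 := card_filter_lt n a (by omega)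
  set S0 := Finset.univ.filter (fun v : Fin n => v.val < a) with hS0def
  have hrad : ∀ S : Finset (Fin n), S.card = a → specRad (joinOn S) = l := by
    intro S hS
    exact specRad_joinOn S l (by rw [hS]; exact hl) hl0 (by omega)
  have hmain := main_struct (V := Fin n) a ha hnR l hl0 hl
  constructor
  · rintro ⟨_, hfree, hmax⟩
    have h1 := hmax (joinOn S0) (joinOn_cliqueFree S0 k (by omega))
      (joinOn_free S0 _ (by omega))
    rw [hrad S0 hS0] at h1
    obtain ⟨S, hS, rfl⟩ := hmain G hfree _ (specRad_mem G).1 h1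
    exact joinOn_iso S S0 (by omega)
  · rintro ⟨e⟩
    obtain ⟨S, hS, rfl⟩ := eq_joinOn_of_iso G S0 e
    rw [hS0] at hS
    refine ⟨joinOn_cliqueFree S k (by omega), joinOn_free S _ (by omega), ?_⟩
    intro H _ hfree
    rw [hrad S hS]
    by_contra hc
    obtain ⟨T, hT, rfl⟩ := hmain H hfree _ (specRad_mem H).1 (not_le.1 hc).le
    exact hc (hrad T hT).le
end

section
/- Under the standing setup, if v is a vertex of G with x_v = m x_z where 1/(2(h+1)) ≤ m ≤ 1, then the degree of v in G satisfies d_G(v) > (m - 1/(6(h+1)))n. -/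
open SimpleGraph Matrix

lemma aux_forest (n h s : ℕ) (hs2 : s ≤ 2 * h + 2) (G : SimpleGraph (Fin n))
    (T : Finset (Fin n)) (hT : T.card = h + 1)
    (hdeg : ∀ t ∈ T, 3 * (h + 1) ≤ degOf G t) : ContainsLinForest G s := by
  classical
  have hN : ∀ t : Fin n, degOf G t = (Finset.univ.filter (G.Adj t)).card := by
    intro t
    rw [degOf, ← Set.ncard_coe_finset]; congr 1; ext w; simp
  have hall : ∃ f : (T × Bool) → Fin n, Function.Injective f ∧
      ∀ p, f p ∈ (Finset.univ.filter (G.Adj (p.1 : Fin n))) \ T := by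
    rw [← Finset.all_card_le_biUnion_card_iff_exists_injective
      (fun p : T × Bool => (Finset.univ.filter (G.Adj (p.1 : Fin n))) \ T)]
    intro S
    rcases S.eq_empty_or_nonempty with rfl | ⟨p, hp⟩
    · simp
    · have h1 : S.card ≤ 2 * (h + 1) := by
        refine (Finset.card_le_univ S).trans ?_
        simp [hT]; omega
      have h2 := Finset.card_le_card (Finset.subset_biUnion_of_mem
        (fun p : T × Bool => (Finset.univ.filter (G.Adj (p.1 : Fin n))) \ T) hp)
      have h3 := Finset.le_card_sdiff T (Finset.univ.filter (G.Adj (p.1 : Fin n)))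
      have h4 := hdeg p.1 p.1.2
      rw [hN] at h4
      omega
  obtain ⟨f, hf, hfm⟩ := hall
  have hfa : ∀ p, G.Adj (p.1 : Fin n) (f p) := fun p => by have := hfm p; simp at this; exact this.1
  have hfT : ∀ p, f p ∉ T := fun p => by have := hfm p; simp at this; exact this.2
  obtain ⟨P, -, hP⟩ : ∃ P ⊆ (Finset.univ : Finset (T × Bool)), P.card = s := by
    apply Finset.exists_subset_card_eq
    simp [hT]; omega
  let H : SimpleGraph (Fin n) :=
    { Adj := fun a b => ∃ p ∈ P, (a = p.1 ∧ b = f p) ∨ (b = p.1 ∧ a = f p)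
      symm := ⟨fun a b => by rintro ⟨p, hp, h⟩; exact ⟨p, hp, h.symm⟩⟩
      loopless := ⟨by
        rintro a ⟨p, hp, ⟨h1, h2⟩ | ⟨h1, h2⟩⟩ <;>
        exact hfT p (by rw [← h2, h1]; exact p.1.2)⟩ }
  have hleaf : ∀ p b, H.Adj (f p) b → b = p.1 := by
    rintro p b ⟨q, hq, ⟨h1, h2⟩ | ⟨h1, h2⟩⟩
    · exact absurd q.1.2 (h1 ▸ hfT p)
    · rw [hf h2]; exact h1
  have hcen : ∀ t : T, ∀ b, H.Adj t b → b = f (t, true) ∨ b = f (t, false) := by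
    rintro t b ⟨q, hq, ⟨h1, h2⟩ | ⟨h1, h2⟩⟩
    · have : t = q.1 := Subtype.ext h1
      subst this
      obtain ⟨q1, q2⟩ := q
      cases q2 <;> simp [h2]
    · exact absurd t.2 (h2 ▸ hfT q)
  have key : ∀ p : T × Bool, ¬ (H \ SimpleGraph.fromEdgeSet {s((p.1 : Fin n), f p)}).Reachable (f p) p.1 := by
    rintro p ⟨w⟩
    have hne : f p ≠ p.1 := fun h => hfT p (h ▸ p.1.2)
    generalize hc : (p.1 : Fin n) = c at w hne
    cases w with
    | nil => exact hne rfl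
    | cons hadj _ =>
      rw [← hc] at hadj
      rw [SimpleGraph.sdiff_adj] at hadj
      have := hleaf _ _ hadj.1
      rw [this] at hadj
      rw [← hc] at hne
      exact hadj.2 (by simp [SimpleGraph.fromEdgeSet_adj, Sym2.eq_swap, hne])
  refine ⟨H, ?_, ⟨?_, ?_⟩, ?_⟩
  · rintro a b ⟨p, hp, ⟨h1, h2⟩ | ⟨h1, h2⟩⟩
    · rw [h1, h2]; exact hfa p
    · rw [h1, h2]; exact (hfa p).symm
  · rw [SimpleGraph.isAcyclic_iff_forall_adj_isBridge]
    rintro a b ⟨p, hp, ⟨h1, h2⟩ | ⟨h1, h2⟩⟩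
    · rw [SimpleGraph.isBridge_iff]
      subst h1 h2
      intro hr; exact key p hr.symm
    · rw [SimpleGraph.isBridge_iff]
      subst h1 h2
      rw [Sym2.eq_swap]
      exact key p
  · intro a
    by_cases ha : a ∈ T
    · refine (Set.ncard_le_ncard (t := {f (⟨a, ha⟩, true), f (⟨a, ha⟩, false)}) ?_ (Set.toFinite _)).trans
        ((Set.ncard_insert_le _ _).trans (by simp))
      intro b hb
      exact hcen ⟨a, ha⟩ b hb
    · have : ∀ b c, H.Adj a b → H.Adj a c → b = c := by
        rintro b c ⟨p, hp, ⟨h1, h2⟩ | ⟨h1, h2⟩⟩ hc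
        · exact absurd p.1.2 (h1 ▸ ha)
        · subst h2
          rw [h1, hleaf _ _ hc]
      have h1 : {w | H.Adj a w}.ncard ≤ 1 := by
        rw [Set.ncard_le_one (Set.toFinite _)]
        intro b hb c hc; exact this b c hb hc
      omega
  · have : H.edgeSet = ((P.image (fun p => s((p.1 : Fin n), f p)) : Finset _) : Set (Sym2 (Fin n))) := by
      ext e
      induction e with | _ a b => ?_
      simp only [SimpleGraph.mem_edgeSet, Finset.coe_image, Set.mem_image, Finset.mem_coe]
      constructor
      · rintro ⟨p, hp, ⟨h1, h2⟩ | ⟨h1, h2⟩⟩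
        · exact ⟨p, hp, by rw [h1, h2]⟩
        · exact ⟨p, hp, by rw [h1, h2, Sym2.eq_swap]⟩
      · rintro ⟨p, hp, he⟩
        rw [Sym2.eq_iff] at he
        refine ⟨p, hp, ?_⟩
        rcases he with ⟨h1, h2⟩ | ⟨h1, h2⟩
        · exact Or.inl ⟨h1.symm, h2.symm⟩
        · exact Or.inr ⟨h1.symm, h2.symm⟩
    rw [this, Set.ncard_coe_finset, Finset.card_image_of_injective, hP]
    intro p q hpq
    simp only [Sym2.eq_iff] at hpq
    rcases hpq with ⟨_, h2⟩ | ⟨h1, _⟩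
    · exact hf h2
    · exact absurd p.1.2 (h1 ▸ hfT q)

lemma aux_specRad_ge {n : ℕ} (G : SimpleGraph (Fin n)) (y : Fin n → ℝ) (hy : y ≠ 0) (c : ℝ)
    (he : adjMat G *ᵥ y = c • y) : c ≤ specRad G := by
  apply le_csSup
  · exact (Matrix.finite_spectrum (adjMat G)).bddAbove
  · rw [← Matrix.spectrum_toLin', ← Module.End.hasEigenvalue_iff_mem_spectrum]
    exact Module.End.hasEigenvalue_of_hasEigenvector (x := y)
      ⟨by rw [Module.End.mem_eigenspace_iff, Matrix.toLin'_apply, he], hy⟩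

lemma aux_bip (n k s h : ℕ) (hk : 2 ≤ k) (hhs : 2 * h < s) (h1 : 1 ≤ h) (hn : h < n)
    (G : SimpleGraph (Fin n)) (hG : IsExtremal n k s G) :
    Real.sqrt ((h : ℝ) * (n - h)) ≤ specRad G := by
  classical
  let K : SimpleGraph (Fin n) :=
    { Adj := fun a b => ¬ ((a : ℕ) < h ↔ (b : ℕ) < h)
      symm := ⟨fun a b hab h' => hab h'.symm⟩
      loopless := ⟨fun a ha => ha Iff.rfl⟩ }
  have hcol : K.CliqueFree (k + 1) := by
    have hc : K.Colorable 2 := by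
      have := (SimpleGraph.Coloring.mk (G := K) (α := Bool) (fun a => decide ((a : ℕ) < h))
        (by intro a b hab heq; exact hab (by simpa using heq))).colorable
      simpa using this
    exact hc.cliqueFree (by omega)
  have hcardA : (Finset.univ.filter (fun a : Fin n => (a : ℕ) < h)).card = h := by
    rw [Fin.card_filter_val_lt]; omega
  have hcardB : (Finset.univ.filter (fun a : Fin n => ¬ (a : ℕ) < h)).card = n - h := by
    have := Finset.card_filter_add_card_filter_not (s := (Finset.univ : Finset (Fin n))) (fun a : Fin n => (a : ℕ) < h)
    rw [hcardA] at this; simp at this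
    simp only [not_lt]; omega
  have hfor : ¬ ContainsLinForest K s := by
    rintro ⟨H, hHK, ⟨-, hd⟩, hcard⟩
    have hsub : H.edgeSet ⊆ ((Finset.univ.filter (fun a : Fin n => (a : ℕ) < h)).biUnion
        (fun a => (Finset.univ.filter (H.Adj a)).image (fun b => s(a, b))) : Finset _) := by
      intro e he
      induction e with | _ a b => ?_
      rw [SimpleGraph.mem_edgeSet] at he
      have hab : ¬ ((a : ℕ) < h ↔ (b : ℕ) < h) := hHK he
      simp only [Finset.coe_biUnion, Set.mem_iUnion]
      by_cases ha : (a : ℕ) < h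
      · exact ⟨a, by simpa using ha, by simp; exact ⟨b, he, Or.inl rfl⟩⟩
      · have hb : (b : ℕ) < h := by tauto
        refine ⟨b, by simpa using hb, ?_⟩
        simp only [Finset.coe_image, Set.mem_image]
        exact ⟨a, by simpa using he.symm, Sym2.eq_swap⟩
    have hle := Set.ncard_le_ncard hsub (Set.toFinite _)
    rw [Set.ncard_coe_finset, hcard] at hle
    have h2 : ((Finset.univ.filter (fun a : Fin n => (a : ℕ) < h)).biUnion
        (fun a => (Finset.univ.filter (H.Adj a)).image (fun b => s(a, b)))).card ≤ h * 2 := by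
      conv_rhs => rw [← hcardA]
      apply Finset.card_biUnion_le_card_mul
      intro a _
      refine Finset.card_image_le.trans ?_
      have := hd a
      rw [← Set.ncard_coe_finset]
      have hset : ((Finset.univ.filter (H.Adj a) : Finset (Fin n)) : Set (Fin n)) = {w | H.Adj a w} := by
        ext w; simp
      rw [hset]
      exact this
    omega
  refine le_trans ?_ (hG.2.2 K hcol hfor)
  have hhp : (0 : ℝ) < h := by exact_mod_cast h1
  have hnp : (0 : ℝ) < (n : ℝ) - h := by
    have : (h : ℝ) < n := by exact_mod_cast hn
    linarith
  have hsh : Real.sqrt h * Real.sqrt h = h := Real.mul_self_sqrt hhp.le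
  have hsn : Real.sqrt (n - h) * Real.sqrt (n - h) = n - h := Real.mul_self_sqrt hnp.le
  apply aux_specRad_ge K (fun a => if (a : ℕ) < h then Real.sqrt (n - h) else Real.sqrt h)
  · intro h0
    have := congrFun h0 ⟨0, by omega⟩
    simp only [Pi.zero_apply] at this
    rw [if_pos (by omega)] at this
    exact (Real.sqrt_pos.2 hnp).ne' this
  · ext a
    rw [Real.sqrt_mul hhp.le]
    simp only [Matrix.mulVec, dotProduct, adjMat, Pi.smul_apply, smul_eq_mul]
    by_cases ha : (a : ℕ) < h
    · have : ∀ b : Fin n, (if K.Adj a b then (1 : ℝ) else 0) * (if (b : ℕ) < h then Real.sqrt (n - h) else Real.sqrt h)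
          = if ¬ (b : ℕ) < h then Real.sqrt h else 0 := by
        intro b
        by_cases hb : (b : ℕ) < h <;> simp [K, ha, hb]
      trans ∑ b : Fin n, (if ¬ (b : ℕ) < h then Real.sqrt h else 0 : ℝ)
      · refine Finset.sum_congr rfl (fun b _ => ?_)
        convert this b
      rw [← Finset.sum_filter, Finset.sum_const, hcardB,
        if_pos ha, nsmul_eq_mul, Nat.cast_sub hn.le, mul_assoc, hsn]
      ring
    · have : ∀ b : Fin n, (if K.Adj a b then (1 : ℝ) else 0) * (if (b : ℕ) < h then Real.sqrt (n - h) else Real.sqrt h)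
          = if (b : ℕ) < h then Real.sqrt (n - h) else 0 := by
        intro b
        by_cases hb : (b : ℕ) < h <;> simp [K, ha, hb]
      trans ∑ b : Fin n, (if (b : ℕ) < h then Real.sqrt (n - h) else 0 : ℝ)
      · refine Finset.sum_congr rfl (fun b _ => ?_)
        convert this b
      rw [← Finset.sum_filter, Finset.sum_const, hcardA,
        if_neg ha, nsmul_eq_mul]
      linear_combination -Real.sqrt (n - h) * hsh

lemma aux_num (H n d m ρ : ℝ) (hH : 2 ≤ H) (hm1 : 1 / (2 * H) ≤ m) (hm2 : m ≤ 1)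
    (hn : 36288 * H ^ 8 ≤ n) (hρ0 : 0 < ρ) (hρ : (H - 1) * (n - (H - 1)) ≤ ρ ^ 2)
    (hmain : ρ ^ 2 * m ≤ d * (m + (H - 1) - 1) + (((H - 1) + 3 * H) * n) * (3 * H / ρ)) :
    (m - 1 / (6 * H)) * n < d := by
  have hHp : 0 < H := by linarith
  have hH8 : H ≤ H ^ 8 := le_self_pow₀ (by linarith) (by norm_num)
  have hnp : 0 < n := by nlinarith
  have hm0 : 0 < m := lt_of_lt_of_le (by positivity) hm1
  have hρ2 : 180 * H ^ 4 ≤ ρ := by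
    have : (180 * H ^ 4) ^ 2 ≤ ρ ^ 2 := by
      have e : (180 * H ^ 4) ^ 2 = 32400 * H ^ 8 := by ring
      rw [e]
      have : 0 ≤ (H - 2) * (n - (H - 1)) := mul_nonneg (by linarith) (by linarith)
      nlinarith
    exact le_of_sq_le_sq this hρ0.le
  have herr : (((H - 1) + 3 * H) * n) * (3 * H / ρ) ≤ n / (15 * H ^ 2) := by
    have h1 : 3 * H / ρ ≤ 1 / (60 * H ^ 3) := by
      rw [div_le_div_iff₀ hρ0 (by positivity)]
      nlinarith
    calc (((H - 1) + 3 * H) * n) * (3 * H / ρ) ≤ (4 * H * n) * (1 / (60 * H ^ 3)) := by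
          gcongr; linarith
      _ = n / (15 * H ^ 2) := by field_simp; norm_num
  by_contra hcon
  push Not at hcon
  have hq : 0 < m + (H - 1) - 1 := by linarith
  have h1 : d * (m + (H - 1) - 1) ≤ (m - 1 / (6 * H)) * n * (m + (H - 1) - 1) := by gcongr
  have h2 : (H - 1) * (n - (H - 1)) * m ≤ ρ ^ 2 * m := by gcongr
  have h3 : m * (m + (H - 1) - 1) * n ≤ (H - 1) * m * n := by
    have : m * (m + (H - 1) - 1) ≤ m * (H - 1) := by gcongr; linarith
    nlinarith
  have h4 : 1 / (2 * H) * (1 / (6 * H) * n) ≤ (m + (H - 1) - 1) * (1 / (6 * H) * n) := by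
    gcongr; linarith
  have h5 : (H - 1) ^ 2 * m ≤ H ^ 2 := by
    have : (H - 1) ^ 2 * m ≤ (H - 1) ^ 2 * 1 := by gcongr
    nlinarith
  have h6 : 1 / (2 * H) * (1 / (6 * H) * n) ≤ H ^ 2 + n / (15 * H ^ 2) := by nlinarith
  have e6 : 1 / (2 * H) * (1 / (6 * H) * n) = n / (15 * H ^ 2) + n / (60 * H ^ 2) := by
    field_simp; norm_num
  have h7 : n / (60 * H ^ 2) ≤ H ^ 2 := by linarith
  rw [div_le_iff₀ (by positivity)] at h7
  have h8 : H ^ 4 ≤ H ^ 8 := pow_le_pow_right₀ (by linarith) (by norm_num)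
  have : 0 < H ^ 4 := by positivity
  nlinarith

/-- Under the standing setup, if `x_v = m x_z` with `1/(2(h+1)) ≤ m ≤ 1`, then
`d_G(v) > (m - 1/(6(h+1))) n`. -/
theorem degree_gt_of_eigvec_large
    (k s n : ℕ) (hk : 2 ≤ k) (hs : 3 ≤ s)
    (h : ℕ) (hh : h = (s - 1) / 2) (α : ℝ) (hα : α = 1 / (36 * ((h : ℝ) + 1) ^ 3))
    (hn : 28 * ((h : ℝ) + 1) ^ 2 / α ^ 2 ≤ (n : ℝ))
    (G : SimpleGraph (Fin n)) (hG : IsExtremal n k s G)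
    (x : Fin n → ℝ) (hxpos : ∀ v, 0 < x v) (hxnorm : ∑ v, x v ^ 2 = 1)
    (heig : adjMat G *ᵥ x = specRad G • x)
    (z : Fin n) (hz : ∀ v, x v ≤ x z)
    (v : Fin n) (m : ℝ) (hm : x v = m * x z)
    (hm1 : 1 / (2 * ((h : ℝ) + 1)) ≤ m) (hm2 : m ≤ 1) :
    (m - 1 / (6 * ((h : ℝ) + 1))) * (n : ℝ) < (degOf G v : ℝ) := by
  classical
  have hh1 : 1 ≤ h := by omega
  have hhR : (1 : ℝ) ≤ h := by exact_mod_cast hh1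
  have hnn : 36288 * ((h : ℝ) + 1) ^ 8 ≤ n := by
    refine le_of_eq_of_le ?_ hn
    rw [hα]; field_simp; norm_num
  have hlt : h < n := by
    have : ((h : ℝ) + 1) ≤ ((h : ℝ) + 1) ^ 8 := le_self_pow₀ (by linarith) (by norm_num)
    have : (h : ℝ) < n := by linarith
    exact_mod_cast this
  have hltR : (h : ℝ) < n := by exact_mod_cast hlt
  set ρ := specRad G with hρdef
  have hρs := aux_bip n k s h hk (by omega) hh1 hlt G hG
  rw [← hρdef] at hρs
  have hpp : (0 : ℝ) < h * (n - h) := mul_pos (by linarith) (by linarith)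
  have hρ0 : 0 < ρ := lt_of_lt_of_le (Real.sqrt_pos.2 hpp) hρs
  have hρ2 : (h : ℝ) * (n - h) ≤ ρ ^ 2 := (Real.sqrt_le_left hρ0.le).1 hρs
  let N : Fin n → Finset (Fin n) := fun u => Finset.univ.filter (G.Adj u)
  have hN : ∀ t : Fin n, degOf G t = (N t).card := by
    intro t
    rw [degOf, ← Set.ncard_coe_finset]; congr 1; ext w; simp [N]
  have hev : ∀ u, ρ * x u = ∑ w ∈ N u, x w := by
    intro u
    have := congrFun heig u
    simp only [Matrix.mulVec, dotProduct, adjMat, Pi.smul_apply, smul_eq_mul, ite_mul, one_mul,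
      zero_mul] at this
    rw [← this, ← Finset.sum_filter]
  let B : Finset (Fin n) := Finset.univ.filter (fun u => 3 * (h + 1) ≤ degOf G u)
  have hB : B.card ≤ h := by
    by_contra hcon
    obtain ⟨T, hTB, hT⟩ := Finset.exists_subset_card_eq (s := B) (n := h + 1) (by omega)
    apply hG.2.1
    apply aux_forest n h s (by omega) G T hT
    intro t ht
    have := hTB ht
    simpa [B] using this
  have hxz := hxpos z
  have hdsm : ∀ u, u ∉ B → ((N u).card : ℝ) ≤ 3 * ((h : ℝ) + 1) := by
    intro u hu
    have : (N u).card ≤ 3 * (h + 1) := by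
      rw [← hN]; simp [B] at hu; omega
    exact_mod_cast this
  have hsm : ∀ u, u ∉ B → x u ≤ 3 * ((h : ℝ) + 1) / ρ * x z := by
    intro u hu
    rw [div_mul_eq_mul_div, le_div_iff₀ hρ0, mul_comm, hev]
    calc ∑ w ∈ N u, x w ≤ ∑ w ∈ N u, x z := Finset.sum_le_sum (fun w _ => hz w)
      _ = (N u).card * x z := by rw [Finset.sum_const, nsmul_eq_mul]
      _ ≤ _ := by have := hdsm u hu; gcongr
  set δ := 3 * ((h : ℝ) + 1) / ρ with hδ
  have hδ0 : 0 < δ := by positivity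
  -- v is in B
  have hvB : v ∈ B := by
    by_contra hv
    have h1 := hsm v hv
    rw [hm] at h1
    have h2 : m ≤ δ := le_of_mul_le_mul_right h1 hxz
    have h3 : 1 / (2 * ((h : ℝ) + 1)) ≤ 3 * ((h : ℝ) + 1) / ρ := hm1.trans h2
    rw [div_le_div_iff₀ (by positivity) hρ0] at h3
    have h4 : ρ ≤ 6 * ((h : ℝ) + 1) ^ 2 := by nlinarith
    have h5 : ρ ^ 2 ≤ (6 * ((h : ℝ) + 1) ^ 2) ^ 2 := by gcongr
    have e : (6 * ((h : ℝ) + 1) ^ 2) ^ 2 = 36 * ((h : ℝ) + 1) ^ 4 := by ring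
    have h6 : ((h : ℝ) + 1) ^ 4 ≤ ((h : ℝ) + 1) ^ 8 :=
      pow_le_pow_right₀ (by linarith) (by norm_num)
    have h7 : ((h : ℝ) + 1) ≤ ((h : ℝ) + 1) ^ 8 := le_self_pow₀ (by linarith) (by norm_num)
    have h8 : (n : ℝ) - h ≤ h * (n - h) := le_mul_of_one_le_left (by linarith) hhR
    rw [e] at h5
    linarith
  have hBsum : ∑ w ∈ B, x w ≤ (m + h - 1) * x z := by
    rw [← Finset.add_sum_erase B x hvB]
    have h1 : ∑ w ∈ B.erase v, x w ≤ (B.erase v).card * x z := by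
      rw [← nsmul_eq_mul, ← Finset.sum_const]
      exact Finset.sum_le_sum (fun w _ => hz w)
    have h2 : ((B.erase v).card : ℝ) ≤ h - 1 := by
      have := Finset.card_erase_add_one hvB
      have h3 : (B.erase v).card + 1 ≤ h := by omega
      have h4 : ((B.erase v).card : ℝ) + 1 ≤ h := by exact_mod_cast h3
      linarith
    have h5 : ((B.erase v).card : ℝ) * x z ≤ (h - 1) * x z := by gcongr
    rw [hm]; linarith
  have hstep : ∀ u, ρ * x u ≤ (m + h - 1) * x z + (N u).card * (δ * x z) := by
    intro u
    rw [hev, ← Finset.sum_filter_add_sum_filter_not (N u) (fun w => w ∈ B)]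
    apply add_le_add
    · refine le_trans (Finset.sum_le_sum_of_subset_of_nonneg ?_ (fun w _ _ => (hxpos w).le)) hBsum
      intro w hw; exact (Finset.mem_filter.1 hw).2
    · calc ∑ w ∈ (N u).filter (fun w => ¬ w ∈ B), x w
          ≤ ∑ w ∈ (N u).filter (fun w => ¬ w ∈ B), δ * x z :=
            Finset.sum_le_sum (fun w hw => hsm w (Finset.mem_filter.1 hw).2)
        _ = ((N u).filter (fun w => ¬ w ∈ B)).card * (δ * x z) := by
            rw [Finset.sum_const, nsmul_eq_mul]
        _ ≤ _ := by
            gcongr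
            exact Finset.filter_subset _ _
  have hdegsum : ∑ u, ((N u).card : ℝ) ≤ (h + 3 * ((h : ℝ) + 1)) * n := by
    rw [← Finset.sum_filter_add_sum_filter_not Finset.univ (fun w => w ∈ B), add_mul]
    apply add_le_add
    · calc ∑ u with u ∈ B, ((N u).card : ℝ) ≤ ∑ u with u ∈ B, (n : ℝ) := by
            apply Finset.sum_le_sum
            intro u _
            have := Finset.card_le_univ (N u)
            rw [Fintype.card_fin] at this
            exact_mod_cast this
        _ = B.card * n := by
            rw [Finset.sum_const, nsmul_eq_mul, Finset.filter_mem_eq_inter, Finset.univ_inter]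
        _ ≤ h * n := by gcongr
    · calc ∑ u with ¬ u ∈ B, ((N u).card : ℝ) ≤ ∑ u with ¬ u ∈ B, (3 * ((h : ℝ) + 1)) :=
            Finset.sum_le_sum (fun u hu => hdsm u (Finset.mem_filter.1 hu).2)
        _ ≤ ∑ u : Fin n, (3 * ((h : ℝ) + 1)) :=
            Finset.sum_le_sum_of_subset_of_nonneg (Finset.filter_subset _ _)
              (fun _ _ _ => by positivity)
        _ = _ := by simp; ring
  have hmain : ρ ^ 2 * m ≤ (degOf G v : ℝ) * (m + h - 1) + ((h + 3 * ((h : ℝ) + 1)) * n) * δ := by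
    refine le_of_mul_le_mul_right ?_ hxz
    calc ρ ^ 2 * m * x z = ρ * (ρ * x v) := by rw [hm]; ring
      _ = ∑ u ∈ N v, ρ * x u := by rw [hev, Finset.mul_sum]
      _ ≤ ∑ u ∈ N v, ((m + h - 1) * x z + (N u).card * (δ * x z)) :=
          Finset.sum_le_sum (fun u _ => hstep u)
      _ = (degOf G v : ℝ) * ((m + h - 1) * x z) + (∑ u ∈ N v, ((N u).card : ℝ)) * (δ * x z) := by
          rw [Finset.sum_add_distrib, Finset.sum_const, nsmul_eq_mul, hN, Finset.sum_mul]
      _ ≤ (degOf G v : ℝ) * ((m + h - 1) * x z) + ((h + 3 * ((h : ℝ) + 1)) * n) * (δ * x z) := by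
          gcongr
          exact (Finset.sum_le_sum_of_subset_of_nonneg (Finset.subset_univ _)
              (fun _ _ _ => by positivity)).trans hdegsum
      _ = _ := by ring
  have eh : (h : ℝ) + 1 - 1 = h := by ring
  refine aux_num ((h : ℝ) + 1) n (degOf G v) m ρ (by linarith) hm1 hm2 hnn hρ0 ?_ ?_
  · rw [eh]; exact hρ2
  · rw [eh]; exact hmain
end

section
/- Under the standing setup, every vertex v in the set R = {v ∈ V(G) : x_v ≥ x_z/(2(h+1))} has degree d_G(v) > (1 - 5/(6(h+1)))n in G. -/
open SimpleGraph Matrix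

lemma containsLinForest_of_cherries {V : Type*} [Fintype V] (G : SimpleGraph V) (s m : ℕ)
    (hsm : s ≤ 2 * m) (S : Finset V) (hS : S.card = m)
    (hdeg : ∀ c ∈ S, 3 * m ≤ degOf G c) : ContainsLinForest G s := by
  classical
  obtain ⟨I, hIsub, hIcard⟩ : ∃ I ⊆ S ×ˢ (Finset.univ : Finset Bool), I.card = s := by
    apply Finset.exists_subset_card_eq
    rw [Finset.card_product]
    simp
    omega
  have hI1 : ∀ i : {i // i ∈ I}, i.1.1 ∈ S := by
    intro i
    have := hIsub i.2
    simpa using this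
  let t : {i // i ∈ I} → Finset V := fun i => (Finset.univ.filter (fun w => G.Adj i.1.1 w)) \ S
  have ht : ∀ i, 2 * m ≤ (t i).card := by
    intro i
    have h1 := hdeg _ (hI1 i)
    have h2 : degOf G i.1.1 = (Finset.univ.filter (fun w => G.Adj i.1.1 w)).card := by
      unfold degOf
      rw [← Set.ncard_coe_finset]
      congr 1
      ext w
      simp
    have h3 := Finset.le_card_sdiff S (Finset.univ.filter (fun w => G.Adj i.1.1 w))
    show 2 * m ≤ ((Finset.univ.filter (fun w => G.Adj i.1.1 w)) \ S).card
    omega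
  have hIle : I.card ≤ 2 * m := by omega
  obtain ⟨f, hfinj, hf⟩ :=
    (Finset.all_card_le_biUnion_card_iff_exists_injective t).1 (by
      intro A
      rcases A.eq_empty_or_nonempty with rfl | ⟨a, ha⟩
      · simp
      · have h1 : A.card ≤ 2 * m := by
          have := Finset.card_le_univ A
          simp at this
          omega
        exact h1.trans ((ht a).trans (Finset.card_le_card (Finset.subset_biUnion_of_mem t ha))))
  have hfS : ∀ i, f i ∉ S := by
    intro i
    have := hf i
    simp only [t, Finset.mem_sdiff] at this
    exact this.2
  have hfG : ∀ i : {i // i ∈ I}, G.Adj i.1.1 (f i) := by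
    intro i
    have := hf i
    simp only [t, Finset.mem_sdiff, Finset.mem_filter] at this
    exact this.1.2
  let T : SimpleGraph V :=
    { Adj := fun a b => ∃ i : {i // i ∈ I}, (a = i.1.1 ∧ b = f i) ∨ (b = i.1.1 ∧ a = f i)
      symm := ⟨by
        rintro a b ⟨i, hi⟩
        exact ⟨i, hi.symm⟩⟩
      loopless := ⟨by
        rintro a ⟨i, ⟨h1, h2⟩ | ⟨h1, h2⟩⟩ <;>
        exact hfS i (h2 ▸ h1 ▸ hI1 i)⟩ }
  have hTadj : ∀ a b, T.Adj a b ↔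
    ∃ i : {i // i ∈ I}, (a = i.1.1 ∧ b = f i) ∨ (b = i.1.1 ∧ a = f i) := fun a b => Iff.rfl
  have hTS : ∀ a b, T.Adj a b → a ∈ S → b ∉ S := by
    intro a b hab ha
    rcases (hTadj a b).1 hab with ⟨i, ⟨h1, h2⟩ | ⟨h1, h2⟩⟩
    · rw [h2]; exact hfS i
    · rw [h2] at ha; exact absurd ha (hfS i)
  have hleaf : ∀ a, a ∉ S → {w | T.Adj a w}.ncard ≤ 1 := by
    intro a ha
    rw [Set.ncard_le_one (Set.toFinite _)]
    intro b hb c hc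
    rcases (hTadj a b).1 hb with ⟨i, ⟨h1, h2⟩ | ⟨h1, h2⟩⟩
    · exact absurd (h1 ▸ hI1 i) ha
    rcases (hTadj a c).1 hc with ⟨j, ⟨h3, h4⟩ | ⟨h3, h4⟩⟩
    · exact absurd (h3 ▸ hI1 j) ha
    have : i = j := hfinj (h2 ▸ h4)
    rw [h1, h3, this]
  refine ⟨T, ?_, ⟨?_, ?_⟩, ?_⟩
  · intro a b hab
    rcases (hTadj a b).1 hab with ⟨i, ⟨h1, h2⟩ | ⟨h1, h2⟩⟩
    · rw [h1, h2]; exact hfG i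
    · rw [h1, h2]; exact (hfG i).symm
  · intro v p hp
    have key : ∀ u ∈ p.support, u ∈ S := by
      intro u hu
      by_contra huS
      have h1 := hp.ncard_neighborSet_toSubgraph_eq_two hu
      have h2 : (p.toSubgraph.neighborSet u).ncard ≤ {w | T.Adj u w}.ncard :=
        Set.ncard_le_ncard (p.toSubgraph.neighborSet_subset u) (Set.toFinite _)
      have h3 := hleaf u huS
      omega
    have hv := key v p.start_mem_support
    have hw := key p.snd (p.getVert_mem_support 1)
    exact hTS _ _ (p.adj_snd hp.not_nil) hv hw
  · intro a
    by_cases ha : a ∈ S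
    · let g : Bool → V := fun b => if hb : (a, b) ∈ I then f ⟨(a, b), hb⟩ else a
      have hsub : {w | T.Adj a w} ⊆ Set.range g := by
        intro w hw
        rcases (hTadj a w).1 hw with ⟨⟨⟨c, b⟩, hi⟩, ⟨h1, h2⟩ | ⟨h1, h2⟩⟩
        · simp only at h1
          subst h1
          exact ⟨b, by simp [g, hi, h2]⟩
        · exact absurd (h2 ▸ ha) (hfS _)
      calc _ ≤ (Set.range g).ncard := Set.ncard_le_ncard hsub (Set.toFinite _)
        _ ≤ 2 := by
          rw [← Set.image_univ]
          refine (Set.ncard_image_le (Set.toFinite _)).trans ?_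
          simp [Set.ncard_univ]
    · exact (hleaf a ha).trans (by norm_num)
  · have hE : T.edgeSet = Set.range (fun i : {i // i ∈ I} => s(i.1.1, f i)) := by
      ext e
      induction e using Sym2.ind with
      | _ a b =>
        rw [SimpleGraph.mem_edgeSet, hTadj]
        simp only [Set.mem_range, Sym2.eq_iff]
        constructor
        · rintro ⟨i, ⟨h1, h2⟩ | ⟨h1, h2⟩⟩
          · exact ⟨i, Or.inl ⟨h1.symm, h2.symm⟩⟩
          · exact ⟨i, Or.inr ⟨h1.symm, h2.symm⟩⟩
        · rintro ⟨i, ⟨h1, h2⟩ | ⟨h1, h2⟩⟩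
          · exact ⟨i, Or.inl ⟨h1.symm, h2.symm⟩⟩
          · exact ⟨i, Or.inr ⟨h1.symm, h2.symm⟩⟩
    rw [hE, ← Set.image_univ, Set.ncard_image_of_injective, Set.ncard_univ]
    · simp [hIcard]
    · intro i j hij
      simp only [Sym2.eq_iff] at hij
      rcases hij with ⟨_, h2⟩ | ⟨h1, _⟩
      · exact hfinj h2
      · exact absurd (h1 ▸ hI1 i) (hfS j)

/-- The complete bipartite graph with parts `{0,…,h-1}` and the rest. -/
def bipG (n h : ℕ) : SimpleGraph (Fin n) where
  Adj a b := ¬ ((a.val < h) ↔ (b.val < h))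
  symm := ⟨by intro a b hab; tauto⟩
  loopless := ⟨by intro a ha; tauto⟩

lemma bipG_cliqueFree (n h k : ℕ) (hk : 2 ≤ k) : (bipG n h).CliqueFree (k + 1) := by
  classical
  have C : (bipG n h).Coloring Bool :=
    SimpleGraph.Coloring.mk (fun a => decide (a.val < h)) (by
      intro a b hab
      simp only [bipG] at hab
      simpa [decide_eq_decide] using hab)
  have := C.colorable
  exact this.cliqueFree (by simp; omega)

lemma bipG_free (n h s : ℕ) (hs : 2 * h < s) : ¬ ContainsLinForest (bipG n h) s := by
  classical
  rintro ⟨T, hT, ⟨_, hdeg⟩, hcard⟩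
  let A : Finset (Fin n) := Finset.univ.filter (fun a => a.val < h)
  have hA : A.card ≤ h := by
    have : A.card ≤ (Finset.range h).card :=
      Finset.card_le_card_of_injOn (fun a => a.val) (by intro a ha; simpa [A] using ha)
        (by intro a _ b _ hab; exact Fin.ext hab)
    simpa using this
  have hsub : T.edgeSet ⊆ ⋃ a ∈ A, (fun w => s(a, w)) '' {w | T.Adj a w} := by
    intro e he
    induction e using Sym2.ind with
    | _ a b =>
      rw [SimpleGraph.mem_edgeSet] at he
      have h1 : ¬ ((a.val < h) ↔ (b.val < h)) := hT he
      simp only [Set.mem_iUnion]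
      by_cases ha : a.val < h
      · exact ⟨a, by simpa [A] using ha, b, he, rfl⟩
      · exact ⟨b, by simp [A]; tauto, a, he.symm, Sym2.eq_swap⟩
  have h1 : T.edgeSet.ncard ≤ ∑ a ∈ A, ((fun w => s(a, w)) '' {w | T.Adj a w}).ncard :=
    (Set.ncard_le_ncard hsub (Set.toFinite _)).trans (A.set_ncard_biUnion_le _)
  have h2 : ∑ a ∈ A, ((fun w => s(a, w)) '' {w | T.Adj a w}).ncard ≤ ∑ a ∈ A, 2 :=
    Finset.sum_le_sum (fun a _ => (Set.ncard_image_le (Set.toFinite _)).trans (hdeg a))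
  simp at h2
  omega

lemma bipG_specRad (n h : ℕ) (hh : 0 < h) (hn0 : h < n) :
    Real.sqrt (h * ((n : ℝ) - h)) ≤ specRad (bipG n h) := by
  classical
  have hn : h ≤ n := hn0.le
  unfold specRad
  apply le_csSup
  · exact Matrix.finite_real_spectrum.bddAbove
  have hc1 : (Finset.univ.filter (fun a : Fin n => a.val < h)).card = h := by
    rw [Fin.card_filter_val_lt]
    exact min_eq_right hn
  have hc2 : (Finset.univ.filter (fun a : Fin n => ¬ a.val < h)).card = n - h := by
    have := Finset.card_filter_add_card_filter_not (s := (Finset.univ : Finset (Fin n)))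
      (fun a : Fin n => a.val < h)
    simp only [Finset.card_univ, Fintype.card_fin] at this
    omega
  let y : Fin n → ℝ := fun a => if a.val < h then Real.sqrt ((n : ℝ) - h) else Real.sqrt h
  have hn' : (0 : ℝ) ≤ (n : ℝ) - h := by
    rw [sub_nonneg]; exact_mod_cast hn
  have hy : adjMat (bipG n h) *ᵥ y = Real.sqrt (h * ((n : ℝ) - h)) • y := by
    ext a
    rw [Matrix.mulVec, dotProduct, Pi.smul_apply, smul_eq_mul, Real.sqrt_mul (by positivity)]
    by_cases ha : a.val < h
    · have : ∀ b, adjMat (bipG n h) a b * y b = if ¬ b.val < h then Real.sqrt h else 0 := by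
        intro b
        by_cases hb : b.val < h <;> simp [adjMat, bipG, y, ha, hb]
      simp_rw [this]
      rw [← Finset.sum_filter, Finset.sum_const, hc2, nsmul_eq_mul, Nat.cast_sub hn]
      simp only [y, ha, if_true]
      rw [mul_assoc, Real.mul_self_sqrt hn']
      ring
    · have : ∀ b, adjMat (bipG n h) a b * y b =
          if b.val < h then Real.sqrt ((n : ℝ) - h) else 0 := by
        intro b
        by_cases hb : b.val < h <;> simp [adjMat, bipG, y, ha, hb]
      simp_rw [this]
      rw [← Finset.sum_filter, Finset.sum_const, hc1, nsmul_eq_mul]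
      simp only [y, ha, if_false]
      rw [mul_right_comm, Real.mul_self_sqrt (by positivity)]
  have hy0 : y ≠ 0 := by
    intro h0
    have := congrFun h0 ⟨h, hn0⟩
    simp [y] at this
    omega
  have hev : Module.End.HasEigenvector (Matrix.toLin' (adjMat (bipG n h)))
      (Real.sqrt (h * ((n : ℝ) - h))) y := by
    rw [Module.End.hasEigenvector_iff, Module.End.mem_eigenspace_iff]
    exact ⟨by rw [Matrix.toLin'_apply, hy], hy0⟩
  have := (Module.End.hasEigenvalue_of_hasEigenvector hev).mem_spectrum
  rwa [Matrix.spectrum_toLin'] at this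

set_option maxHeartbeats 2000000 in
/-- Under the standing setup, every vertex of `R = {v : x_v ≥ x_z/(2(h+1))}` has degree
greater than `(1 - 5/(6(h+1))) n`. -/
theorem degree_R_gt
    (k s n : ℕ) (hk : 2 ≤ k) (hs : 3 ≤ s)
    (h : ℕ) (hh : h = (s - 1) / 2) (α : ℝ) (hα : α = 1 / (36 * ((h : ℝ) + 1) ^ 3))
    (hn : 28 * ((h : ℝ) + 1) ^ 2 / α ^ 2 ≤ (n : ℝ))
    (G : SimpleGraph (Fin n)) (hG : IsExtremal n k s G)
    (x : Fin n → ℝ) (hxpos : ∀ v, 0 < x v) (hxnorm : ∑ v, x v ^ 2 = 1)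
    (heig : adjMat G *ᵥ x = specRad G • x)
    (z : Fin n) (hz : ∀ v, x v ≤ x z)
    (v : Fin n) (hv : x z / (2 * ((h : ℝ) + 1)) ≤ x v) :
    (1 - 5 / (6 * ((h : ℝ) + 1))) * (n : ℝ) < (degOf G v : ℝ) := by
  classical
  obtain ⟨-, hfree, hmax⟩ := hG
  have hh1 : 1 ≤ h := by omega
  set m : ℝ := (h : ℝ) + 1 with hm
  have hm2 : (2 : ℝ) ≤ m := by
    have : (1 : ℝ) ≤ h := by exact_mod_cast hh1
    linarith
  have hn2 : 36288 * m ^ 8 ≤ (n : ℝ) := by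
    have : 28 * m ^ 2 / α ^ 2 = 36288 * m ^ 8 := by
      rw [hα]; field_simp; norm_num
    rwa [this] at hn
  have hm6 : m ^ 6 ≤ m ^ 8 := pow_le_pow_right₀ (by linarith) (by norm_num)
  have hm3 : m ^ 3 ≤ m ^ 6 := pow_le_pow_right₀ (by linarith) (by norm_num)
  have hm23 : m ^ 2 ≤ m ^ 3 := pow_le_pow_right₀ (by linarith) (by norm_num)
  have hm12 : m ≤ m ^ 2 := by nlinarith
  have hhm : (h : ℝ) = m - 1 := by rw [hm]; ring
  have hhn : h < n := by
    have : (h : ℝ) < n := by nlinarith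
    exact_mod_cast this
  set ρ := specRad G with hρ
  have hsq : Real.sqrt (h * ((n : ℝ) - h)) ≤ ρ :=
    (bipG_specRad n h hh1 hhn).trans
      (hmax _ (bipG_cliqueFree n h k hk) (bipG_free n h s (by omega)))
  have hnh : 0 ≤ (n : ℝ) - h := by nlinarith
  have hρ0 : 0 ≤ ρ := (Real.sqrt_nonneg _).trans hsq
  have hρ2 : h * ((n : ℝ) - h) ≤ ρ ^ 2 := (Real.sqrt_le_left hρ0).1 hsq
  have hρbig : 36 * m ^ 3 ≤ ρ := by
    apply le_of_sq_le_sq _ hρ0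
    have h1 : (n : ℝ) - h ≤ h * ((n : ℝ) - h) := by nlinarith
    have h2 : (36 * m ^ 3) ^ 2 = 1296 * m ^ 6 := by ring
    nlinarith
  have hρpos : 0 < ρ := by
    have : 0 < m ^ 3 := by positivity
    linarith
  -- entries
  set A := adjMat G with hA
  have hA0 : ∀ a b, 0 ≤ A a b := by
    intro a b
    simp only [hA, adjMat]
    split_ifs <;> norm_num
  have hA1 : ∀ a b, A a b ≤ 1 := by
    intro a b
    simp only [hA, adjMat]
    split_ifs <;> norm_num
  have hAs : ∀ a b, A a b = A b a := by
    intro a b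
    simp only [hA, adjMat, G.adj_comm]
  have hdeg : ∀ a, (degOf G a : ℝ) = ∑ b, A a b := by
    intro a
    have h2 : degOf G a = (Finset.univ.filter (fun w => G.Adj a w)).card := by
      unfold degOf
      rw [← Set.ncard_coe_finset]
      congr 1
      ext w
      simp
    rw [h2]
    simp only [hA, adjMat]
    rw [Finset.sum_boole]
  have hdn : ∀ a, (degOf G a : ℝ) ≤ n := by
    intro a
    rw [hdeg]
    calc ∑ b, A a b ≤ ∑ _b : Fin n, (1 : ℝ) := Finset.sum_le_sum (fun b _ => hA1 a b)
      _ = n := by simp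
  have he : ∀ a, ∑ b, A a b * x b = ρ * x a := by
    intro a
    have := congrFun heig a
    simpa [Matrix.mulVec, dotProduct] using this
  -- high degree vertices
  let S : Finset (Fin n) := Finset.univ.filter (fun a => 3 * (h + 1) ≤ degOf G a)
  have hS : S.card ≤ h := by
    by_contra hcon
    obtain ⟨S', hS', hc⟩ := Finset.exists_subset_card_eq (show h + 1 ≤ S.card by omega)
    refine hfree (containsLinForest_of_cherries G s (h + 1) (by omega) S' hc ?_)
    intro c hc
    have := hS' hc
    simpa [S] using this
  have hxz := hxpos z
  have hlow : ∀ a, a ∉ S → (degOf G a : ℝ) ≤ 3 * m := by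
    intro a ha
    simp only [S, Finset.mem_filter, Finset.mem_univ, true_and, not_le] at ha
    have : (degOf G a : ℝ) ≤ ((3 * (h + 1) : ℕ) : ℝ) := by exact_mod_cast ha.le
    push_cast at this
    rw [hm]; exact this
  have hlowx : ∀ a, a ∉ S → ρ * x a ≤ 3 * m * x z := by
    intro a ha
    rw [← he]
    calc ∑ b, A a b * x b ≤ ∑ b, A a b * x z :=
          Finset.sum_le_sum (fun b _ => mul_le_mul_of_nonneg_left (hz b) (hA0 a b))
      _ = degOf G a * x z := by rw [← Finset.sum_mul, hdeg]
      _ ≤ _ := mul_le_mul_of_nonneg_right (hlow a ha) hxz.le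
  have hvS : v ∈ S := by
    by_contra hvS
    have h1 := hlowx v hvS
    rw [div_le_iff₀ (by positivity)] at hv
    have h2 : ρ * x z ≤ 3 * m * x z * (2 * m) :=
      calc ρ * x z ≤ ρ * (x v * (2 * m)) := mul_le_mul_of_nonneg_left hv hρ0
        _ = ρ * x v * (2 * m) := by ring
        _ ≤ _ := mul_le_mul_of_nonneg_right h1 (by positivity)
    have h3 : ρ ≤ 6 * m ^ 2 := by
      apply le_of_mul_le_mul_right _ hxz
      nlinarith
    have : 0 < m ^ 2 := by positivity
    nlinarith
  -- two-step walks from z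
  have hwalk : ρ ^ 2 * x z ≤ ∑ w, degOf G w * x w := by
    calc ρ ^ 2 * x z = ρ * ∑ u, A z u * x u := by rw [he]; ring
      _ = ∑ u, A z u * (ρ * x u) := by
        rw [Finset.mul_sum]; exact Finset.sum_congr rfl (fun u _ => by ring)
      _ ≤ ∑ u, 1 * (ρ * x u) := Finset.sum_le_sum (fun u _ =>
          mul_le_mul_of_nonneg_right (hA1 z u) (mul_nonneg hρ0 (hxpos u).le))
      _ = ∑ u, ∑ w, A u w * x w := by simp_rw [he, one_mul]
      _ = ∑ w, ∑ u, A u w * x w := Finset.sum_comm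
      _ = _ := by
        apply Finset.sum_congr rfl
        intro w _
        rw [← Finset.sum_mul, hdeg]
        simp_rw [hAs w]
  have hsplit : ∑ w, (degOf G w : ℝ) * x w =
      ∑ w ∈ S, (degOf G w : ℝ) * x w + ∑ w ∈ Finset.univ \ S, (degOf G w : ℝ) * x w := by
    rw [add_comm, Finset.sum_sdiff (Finset.subset_univ S)]
  have hlowsum : ∑ w ∈ Finset.univ \ S, (degOf G w : ℝ) * x w ≤ n * (x z / (4 * m)) := by
    have hterm : ∀ w ∈ Finset.univ \ S, (degOf G w : ℝ) * x w ≤ x z / (4 * m) := by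
      intro w hw
      have hwS : w ∉ S := by simpa using hw
      have h1 := hlowx w hwS
      have h2 := hlow w hwS
      have hxw := hxpos w
      rw [le_div_iff₀ (by positivity)]
      have h3 : 36 * m ^ 3 * x w ≤ 3 * m * x z :=
        (mul_le_mul_of_nonneg_right hρbig hxw.le).trans h1
      have h4 : 12 * m ^ 2 * x w ≤ x z := by
        apply le_of_mul_le_mul_left _ (show 0 < 3 * m by positivity)
        nlinarith
      calc degOf G w * x w * (4 * m) ≤ 3 * m * x w * (4 * m) := by gcongr
        _ = 12 * m ^ 2 * x w := by ring
        _ ≤ _ := h4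
    calc _ ≤ ∑ w ∈ Finset.univ \ S, x z / (4 * m) := Finset.sum_le_sum hterm
      _ = ((Finset.univ \ S).card : ℝ) * (x z / (4 * m)) := by rw [Finset.sum_const, nsmul_eq_mul]
      _ ≤ _ := by
        apply mul_le_mul_of_nonneg_right _ (by positivity)
        have := Finset.card_le_univ (Finset.univ \ S)
        rw [Fintype.card_fin] at this
        exact_mod_cast this
  have hhighsum : ∑ w ∈ S, (degOf G w : ℝ) * x w ≤ (degOf G v + (h - 1) * n) * x z := by
    rw [← Finset.add_sum_erase S _ hvS, add_mul]
    apply add_le_add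
    · exact mul_le_mul_of_nonneg_left (hz v) (by positivity)
    · calc _ ≤ ∑ w ∈ S.erase v, (n : ℝ) * x z := Finset.sum_le_sum (fun w _ =>
            mul_le_mul (hdn w) (hz w) (hxpos w).le (by positivity))
        _ = ((S.erase v).card : ℝ) * (n * x z) := by rw [Finset.sum_const, nsmul_eq_mul]
        _ ≤ (h - 1) * (n * x z) := by
          apply mul_le_mul_of_nonneg_right _ (by positivity)
          have h1 := Finset.card_erase_of_mem hvS
          have h2 : (S.erase v).card + 1 ≤ h := by
            have := Finset.card_pos.2 ⟨v, hvS⟩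
            omega
          have h3 : ((S.erase v).card : ℝ) + 1 ≤ h := by exact_mod_cast h2
          linarith
        _ = _ := by ring
  have hfin : ρ ^ 2 ≤ degOf G v + (h - 1) * n + n / (4 * m) := by
    apply le_of_mul_le_mul_right _ hxz
    calc ρ ^ 2 * x z ≤ _ := hwalk
      _ ≤ (degOf G v + (h - 1) * n) * x z + n * (x z / (4 * m)) := by
        rw [hsplit]; exact add_le_add hhighsum hlowsum
      _ = _ := by ring
  have hd : (n : ℝ) - h ^ 2 - n / (4 * m) ≤ degOf G v := by nlinarith
  have hh2 : (h : ℝ) ^ 2 < n / (4 * m) := by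
    rw [lt_div_iff₀ (by positivity)]
    have h1 : (h : ℝ) ^ 2 ≤ m ^ 2 := by
      apply pow_le_pow_left₀ (by positivity); linarith
    have h2 : (h : ℝ) ^ 2 * (4 * m) ≤ 4 * m ^ 3 := by
      calc _ ≤ m ^ 2 * (4 * m) := mul_le_mul_of_nonneg_right h1 (by positivity)
        _ = _ := by ring
    have : 0 < m ^ 3 := by positivity
    nlinarith
  have hlast : (1 - 5 / (6 * m)) * (n : ℝ) ≤ n - n / (4 * m) - n / (4 * m) := by
    have : (n : ℝ) - n / (4 * m) - n / (4 * m) - (1 - 5 / (6 * m)) * n = n / (3 * m) := by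
      field_simp; ring
    have h2 : 0 ≤ (n : ℝ) / (3 * m) := by positivity
    linarith
  linarith
end

section
/- Under the standing setup, the set R = {v ∈ V(G) : x_v ≥ x_z/(2(h+1))} has cardinality exactly h. -/
open SimpleGraph Matrix

lemma forest_of_injective {V : Type*} [Fintype V] [DecidableEq V] (G : SimpleGraph V)
    (T : Finset V) (s : ℕ) (S : Finset (T × Bool)) (hS : S.card = s)
    (f : T × Bool → V) (hf : Function.Injective f)
    (hfT : ∀ p, f p ∉ T) (hfa : ∀ p, G.Adj p.1 (f p)) : ContainsLinForest G s := by
  let H : SimpleGraph V :=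
    { Adj := fun a b => ∃ p ∈ S, (a = p.1 ∧ b = f p) ∨ (b = p.1 ∧ a = f p)
      symm := ⟨by
        rintro a b ⟨p, hp, hq⟩
        exact ⟨p, hp, hq.symm⟩⟩
      loopless := ⟨by
        rintro a ⟨p, hp, ⟨h1, h2⟩ | ⟨h1, h2⟩⟩
        · exact hfT p (by rw [← h2, h1]; exact p.1.2)
        · exact hfT p (by rw [← h2, h1]; exact p.1.2)⟩ }
  have hleaf : ∀ p b, H.Adj (f p) b → b = p.1 := by
    rintro p b ⟨q, hq, ⟨h1, h2⟩ | ⟨h1, h2⟩⟩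
    · exact absurd q.1.2 (by rw [← h1]; exact hfT p)
    · rw [hf h2]; exact h1
  refine ⟨H, ?_, ⟨?_, ?_⟩, ?_⟩
  · rintro a b ⟨p, hp, ⟨rfl, rfl⟩ | ⟨rfl, rfl⟩⟩
    · exact hfa p
    · exact (hfa p).symm
  · rw [isAcyclic_iff_forall_adj_isBridge]
    have key : ∀ p : T × Bool, ¬ (H \ fromEdgeSet {s((p.1 : V), f p)}).Reachable (f p) p.1 := by
      rintro p ⟨w⟩
      have hne : f p ≠ p.1 := fun he => hfT p (by rw [he]; exact p.1.2)
      generalize hb : (p.1 : V) = b at w hne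
      cases w with
      | nil => exact hne rfl
      | cons hadj w' =>
        rw [SimpleGraph.sdiff_adj] at hadj
        have := hleaf _ _ hadj.1
        subst this
        apply hadj.2
        rw [fromEdgeSet_adj]
        exact ⟨by simp [hb], hadj.1.ne⟩
    rintro a b ⟨p, hp, ⟨rfl, rfl⟩ | ⟨rfl, rfl⟩⟩
    · rw [isBridge_iff]
      exact fun hr => key p hr.symm
    · rw [isBridge_iff, Sym2.eq_swap]
      exact fun hr => key p hr
  · intro v
    by_cases hv : v ∈ T
    · have : {w | H.Adj v w} ⊆ {f (⟨v, hv⟩, true), f (⟨v, hv⟩, false)} := by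
        rintro w ⟨⟨q, b⟩, hq, ⟨h1, h2⟩ | ⟨h1, h2⟩⟩
        · subst h1
          subst h2
          cases b <;> simp
        · exact absurd hv (by rw [h2]; exact hfT _)
      exact (Set.ncard_le_ncard this (Set.toFinite _)).trans ((Set.ncard_insert_le _ _).trans (by rw [Set.ncard_singleton]))
    · by_cases hp : ∃ p, f p = v
      · obtain ⟨p, rfl⟩ := hp
        have : {w | H.Adj (f p) w} ⊆ {(p.1 : V)} := fun w hw => hleaf p w hw
        have := Set.ncard_le_ncard this (Set.toFinite _)
        rw [Set.ncard_singleton] at this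
        omega
      · have : {w | H.Adj v w} = ∅ := by
          ext w
          simp only [Set.mem_ofPred_eq, Set.mem_empty_iff_false, iff_false]
          rintro ⟨q, hq, ⟨h1, h2⟩ | ⟨h1, h2⟩⟩
          · exact hv (by rw [h1]; exact q.1.2)
          · exact hp ⟨q, h2.symm⟩
        rw [this]; simp
  · have : H.edgeSet = (fun p : T × Bool => s((p.1 : V), f p)) '' (S : Set (T × Bool)) := by
      ext e
      induction e with | _ a b =>
      rw [mem_edgeSet]
      constructor
      · rintro ⟨p, hp, ⟨rfl, rfl⟩ | ⟨rfl, rfl⟩⟩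
        · exact ⟨p, hp, rfl⟩
        · exact ⟨p, hp, Sym2.eq_swap⟩
      · rintro ⟨p, hp, he⟩
        refine ⟨p, hp, ?_⟩
        simp only [Sym2.eq_iff] at he
        rcases he with ⟨h1, h2⟩ | ⟨h1, h2⟩
        · exact Or.inl ⟨h1.symm, h2.symm⟩
        · exact Or.inr ⟨h1.symm, h2.symm⟩
    rw [this, Set.ncard_image_of_injective, Set.ncard_coe_finset, hS]
    intro p q he
    simp only [Sym2.eq_iff] at he
    rcases he with ⟨h1, h2⟩ | ⟨h1, h2⟩
    · exact hf h2
    · exact absurd p.1.2 (by rw [h1]; exact hfT q)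

open Classical in
lemma forest_of_degree {V : Type*} [Fintype V] (G : SimpleGraph V)
    (h s : ℕ) (hs : s ≤ 2 * h + 2) (T : Finset V) (hT : T.card = h + 1)
    (hd : ∀ v ∈ T, 3 * h + 2 ≤ (Finset.univ.filter (G.Adj v)).card) :
    ContainsLinForest G s := by
  have hcard : Fintype.card (T × Bool) = 2 * h + 2 := by
    simp [hT]; ring
  let t : T × Bool → Finset V := fun p => Finset.univ.filter (G.Adj p.1) \ T
  have ht : ∀ p, 2 * h + 2 ≤ (t p).card := by
    intro p
    have h1 := hd p.1 p.1.2
    have h2 : Finset.univ.filter (G.Adj p.1) \ (T.erase p.1) = t p := by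
      ext w
      simp only [t, Finset.mem_sdiff, Finset.mem_filter, Finset.mem_univ, true_and,
        Finset.mem_erase, not_and]
      constructor
      · rintro ⟨h3, h4⟩
        exact ⟨h3, h4 h3.ne'⟩
      · rintro ⟨h3, h4⟩
        exact ⟨h3, fun _ => h4⟩
    have h3 := Finset.le_card_sdiff (T.erase (p.1 : V)) (Finset.univ.filter (G.Adj p.1))
    rw [h2, Finset.card_erase_of_mem p.1.2, hT] at h3
    omega
  obtain ⟨f, hf, hft⟩ := (Finset.all_card_le_biUnion_card_iff_exists_injective t).1 (by
    intro A
    rcases A.eq_empty_or_nonempty with rfl | ⟨p, hp⟩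
    · simp
    · have h1 := Finset.card_le_univ A
      have h2 := Finset.card_le_card (Finset.subset_biUnion_of_mem t hp)
      have h3 := ht p
      omega)
  obtain ⟨S, -, hS⟩ := Finset.exists_subset_card_eq
    (s := (Finset.univ : Finset (T × Bool))) (n := s) (by rw [Finset.card_univ]; omega)
  refine forest_of_injective G T s S hS f hf (fun p => ?_) (fun p => ?_)
  · have := hft p
    simp only [t, Finset.mem_sdiff] at this
    exact this.2
  · have := hft p
    simp only [t, Finset.mem_sdiff, Finset.mem_filter] at this
    exact this.1.2

/-- Complete bipartite graph. -/
def bip (n h : ℕ) : SimpleGraph (Fin n) where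
  Adj a b := ¬ ((a : ℕ) < h ↔ (b : ℕ) < h)
  symm := ⟨fun a b hab => by tauto⟩
  loopless := ⟨fun a ha => by tauto⟩

lemma bip_cliqueFree (n h k : ℕ) (hk : 2 ≤ k) : (bip n h).CliqueFree (k + 1) := by
  have : (bip n h).Colorable 2 := by
    refine ⟨Coloring.mk (fun a => if (a : ℕ) < h then 0 else 1) ?_⟩
    intro a b hab
    have hab' : ¬ ((a : ℕ) < h ↔ (b : ℕ) < h) := hab
    by_cases h1 : (a : ℕ) < h <;> by_cases h2 : (b : ℕ) < h <;> simp_all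
  exact this.cliqueFree (by omega)

lemma bip_forest (n h s : ℕ) (hs : 2 * h < s) : ¬ ContainsLinForest (bip n h) s := by
  classical
  rintro ⟨H, hH, ⟨-, hdeg⟩, hc⟩
  let A : Finset (Fin n) := Finset.univ.filter (fun a => (a : ℕ) < h)
  have hA : A.card ≤ h := by
    have := Finset.card_le_card_of_injOn (s := A) (t := Finset.range h) (fun a => (a : ℕ))
      (by intro a ha; simpa [A] using ha) (by intro a _ b _ hab; exact Fin.ext hab)
    simpa using this
  have hsub : H.edgeFinset ⊆ A.biUnion (fun a => (H.neighborFinset a).image (fun b => s(a, b))) := by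
    intro e he
    induction e with | _ a b =>
    have hab : H.Adj a b := by simpa using he
    have hab' : ¬ ((a : ℕ) < h ↔ (b : ℕ) < h) := hH hab
    simp only [Finset.mem_biUnion, Finset.mem_image, mem_neighborFinset]
    by_cases h1 : (a : ℕ) < h
    · exact ⟨a, by simp [A, h1], b, hab, rfl⟩
    · exact ⟨b, by simp [A]; tauto, a, hab.symm, Sym2.eq_swap⟩
  have h1 := Finset.card_le_card hsub
  have h2 : (A.biUnion (fun a => (H.neighborFinset a).image (fun b => s(a, b)))).card ≤ A.card * 2 := by
    apply Finset.card_biUnion_le_card_mul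
    intro a _
    refine Finset.card_image_le.trans ?_
    have := hdeg a
    rw [← Set.ncard_coe_finset]
    have he : ((H.neighborFinset a : Finset (Fin n)) : Set (Fin n)) = {w | H.Adj a w} := by
      ext w
      simp
    rwa [he]
  have h3 : H.edgeSet.ncard = H.edgeFinset.card := by
    rw [← Set.ncard_coe_finset, coe_edgeFinset]
  omega

lemma bip_specRad (n h : ℕ) (hh : 1 ≤ h) (hn : h < n) :
    √((h : ℝ) * ((n : ℝ) - h)) ≤ specRad (bip n h) := by
  classical
  have hle : (0 : ℝ) ≤ (n : ℝ) - h := by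
    have : (h : ℝ) ≤ n := by exact_mod_cast hn.le
    linarith
  have hh0 : (0 : ℝ) < h := by exact_mod_cast hh
  set ρ := √((h : ℝ) * ((n : ℝ) - h)) with hρ
  let y : Fin n → ℝ := fun a => if (a : ℕ) < h then √((n : ℝ) - h) else √(h : ℝ)
  have cardA : ((Finset.univ.filter (fun a : Fin n => (a : ℕ) < h)).card : ℝ) = h := by
    have := Fin.card_filter_val_lt (n := n) (m := h)
    rw [this, min_eq_right hn.le]
  have cardB : ((Finset.univ.filter (fun a : Fin n => ¬ (a : ℕ) < h)).card : ℝ) = n - h := by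
    have h1 := Finset.card_filter_add_card_filter_not (s := (Finset.univ : Finset (Fin n)))
      (fun a : Fin n => (a : ℕ) < h)
    rw [Finset.card_univ, Fintype.card_fin] at h1
    have h2 : (((Finset.univ.filter (fun a : Fin n => (a : ℕ) < h)).card : ℝ) +
      (Finset.univ.filter (fun a : Fin n => ¬ (a : ℕ) < h)).card) = n := by exact_mod_cast h1
    linarith
  have hprod : ρ = √(h : ℝ) * √((n : ℝ) - h) := Real.sqrt_mul hh0.le _
  have hy : adjMat (bip n h) *ᵥ y = ρ • y := by
    ext a
    simp only [Matrix.mulVec, dotProduct, Pi.smul_apply, smul_eq_mul]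
    by_cases ha : (a : ℕ) < h
    · have : ∀ b, adjMat (bip n h) a b * y b = if ¬ (b : ℕ) < h then √(h : ℝ) else 0 := by
        intro b
        by_cases hb : (b : ℕ) < h <;> simp [adjMat, bip, y, ha, hb]
      simp_rw [this]
      rw [← Finset.sum_filter, Finset.sum_const, nsmul_eq_mul, cardB, hprod]
      simp only [y, ha, if_true]
      rw [mul_assoc, Real.mul_self_sqrt hle]; ring
    · have : ∀ b, adjMat (bip n h) a b * y b = if (b : ℕ) < h then √((n : ℝ) - h) else 0 := by
        intro b
        by_cases hb : (b : ℕ) < h <;> simp [adjMat, bip, y, ha, hb]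
      simp_rw [this]
      rw [← Finset.sum_filter, Finset.sum_const, nsmul_eq_mul, cardA, hprod]
      simp only [y, ha, if_false]
      rw [mul_right_comm, Real.mul_self_sqrt hh0.le]
  have hy0 : y ≠ 0 := by
    intro h0
    have := congrFun h0 ⟨h, hn⟩
    simp only [y, lt_irrefl, if_false, Pi.zero_apply] at this
    exact (Real.sqrt_pos.2 hh0).ne' this
  have hev : Module.End.HasEigenvalue (Matrix.toLin' (adjMat (bip n h))) ρ :=
    Module.End.hasEigenvalue_of_hasEigenvector (x := y)
      ⟨Module.End.mem_eigenspace_iff.2 (by rw [Matrix.toLin'_apply, hy]), hy0⟩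
  have hmem : ρ ∈ spectrum ℝ (adjMat (bip n h)) := by
    have := hev.mem_spectrum
    rwa [Matrix.spectrum_toLin'] at this
  exact le_csSup (Matrix.finite_real_spectrum (A := adjMat (bip n h))).bddAbove hmem

/-- Under the standing setup, the set `R = {v : x_v ≥ x_z/(2(h+1))}` has exactly `h`
elements. -/
theorem card_R_eq
    (k s n : ℕ) (hk : 2 ≤ k) (hs : 3 ≤ s)
    (h : ℕ) (hh : h = (s - 1) / 2) (α : ℝ) (hα : α = 1 / (36 * ((h : ℝ) + 1) ^ 3))
    (hn : 28 * ((h : ℝ) + 1) ^ 2 / α ^ 2 ≤ (n : ℝ))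
    (G : SimpleGraph (Fin n)) (hG : IsExtremal n k s G)
    (x : Fin n → ℝ) (hxpos : ∀ v, 0 < x v) (hxnorm : ∑ v, x v ^ 2 = 1)
    (heig : adjMat G *ᵥ x = specRad G • x)
    (z : Fin n) (hz : ∀ v, x v ≤ x z) :
    Set.ncard {v : Fin n | x z / (2 * ((h : ℝ) + 1)) ≤ x v} = h := by
  classical
  obtain ⟨-, hnf, hmax⟩ := hG
  have hh1 : 1 ≤ h := by omega
  have hh1r : (1 : ℝ) ≤ h := by exact_mod_cast hh1
  have hnbig : 36288 * ((h : ℝ) + 1) ^ 8 ≤ n := by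
    refine le_trans (le_of_eq ?_) hn
    rw [hα]
    field_simp
    norm_num
  have hnbig4 : 36288 * ((h : ℝ) + 1) ^ 4 ≤ n := by
    refine le_trans ?_ hnbig
    have : ((h : ℝ) + 1) ^ 4 ≤ ((h : ℝ) + 1) ^ 8 :=
      pow_le_pow_right₀ (by linarith) (by norm_num)
    linarith
  have hp1 : ((h : ℝ) + 1) ≤ ((h : ℝ) + 1) ^ 4 := le_self_pow₀ (by linarith) (by norm_num)
  have hp2 : ((h : ℝ) + 1) ^ 2 ≤ ((h : ℝ) + 1) ^ 4 :=
    pow_le_pow_right₀ (by linarith) (by norm_num)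
  have hlt : (h : ℝ) < n := by linarith
  have hltn : h < n := by exact_mod_cast hlt
  set ρ := specRad G with hρdef
  have hρ1 : √((h : ℝ) * ((n : ℝ) - h)) ≤ ρ :=
    (bip_specRad n h hh1 hltn).trans
      (hmax _ (bip_cliqueFree n h k hk) (bip_forest n h s (by omega)))
  have hρ0 : 0 ≤ ρ := (Real.sqrt_nonneg _).trans hρ1
  have hρsq : (h : ℝ) * ((n : ℝ) - h) ≤ ρ ^ 2 := (Real.sqrt_le_left hρ0).1 hρ1
  have hρbig : 100 * ((h : ℝ) + 1) ^ 2 ≤ ρ := by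
    refine abs_le_of_sq_le_sq' ?_ hρ0 |>.2
    nlinarith
  have hρpos : 0 < ρ := by nlinarith
  have hn0 : (0 : ℝ) < n := by linarith
  have hxz := hxpos z
  -- eigenvalue equation
  have ha0 : ∀ u w, 0 ≤ adjMat G u w := by
    intro u w; unfold adjMat; split_ifs <;> norm_num
  have ha1 : ∀ u w, adjMat G u w ≤ 1 := by
    intro u w; unfold adjMat; split_ifs <;> norm_num
  have heq : ∀ u, ρ * x u = ∑ w, adjMat G u w * x w := by
    intro u
    have := congrFun heig u
    simpa [Matrix.mulVec, dotProduct] using this.symm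
  let d : Fin n → ℕ := fun u => (Finset.univ.filter (G.Adj u)).card
  have hd : ∀ u, ∑ w, adjMat G u w = d u := by
    intro u
    simp only [adjMat, d]
    rw [Finset.sum_boole]
  have hdx : ∀ u, ρ * x u ≤ d u * x z := by
    intro u
    rw [heq, ← hd, Finset.sum_mul]
    exact Finset.sum_le_sum fun w _ => mul_le_mul_of_nonneg_left (hz w) (ha0 u w)
  let L : Finset (Fin n) := Finset.univ.filter (fun u => 3 * h + 2 ≤ d u)
  have hL : L.card ≤ h := by
    by_contra hcon
    obtain ⟨T, hTL, hT⟩ := Finset.exists_subset_card_eq (s := L) (n := h + 1) (by omega)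
    exact hnf (forest_of_degree G h s (by omega) T hT fun v hv => by
      have := hTL hv
      simpa [L, d] using this)
  let R : Finset (Fin n) := Finset.univ.filter (fun v => x z / (2 * ((h : ℝ) + 1)) ≤ x v)
  have hRset : Set.ncard {v : Fin n | x z / (2 * ((h : ℝ) + 1)) ≤ x v} = R.card := by
    rw [← Set.ncard_coe_finset]
    congr 1
    ext v
    simp [R]
  rw [hRset]
  have hRL : R ⊆ L := by
    intro v hv
    have hv' : x z / (2 * ((h : ℝ) + 1)) ≤ x v := by simpa [R] using hv
    have h1 := hdx v
    rw [div_le_iff₀ (by linarith)] at hv'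
    have h2 : ρ ≤ d v * (2 * ((h : ℝ) + 1)) := by
      have : x z * ρ ≤ x z * (d v * (2 * ((h : ℝ) + 1))) := by
        calc x z * ρ ≤ (x v * (2 * ((h : ℝ) + 1))) * ρ := mul_le_mul_of_nonneg_right hv' hρ0
          _ = (ρ * x v) * (2 * ((h : ℝ) + 1)) := by ring
          _ ≤ (d v * x z) * (2 * ((h : ℝ) + 1)) := mul_le_mul_of_nonneg_right h1 (by linarith)
          _ = _ := by ring
      exact le_of_mul_le_mul_left this hxz
    have h3 : 50 * ((h : ℝ) + 1) ≤ d v := by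
      by_contra hc
      push Not at hc
      nlinarith
    have h4 : ((3 * h + 2 : ℕ) : ℝ) ≤ d v := by push_cast; linarith
    have h5 : 3 * h + 2 ≤ d v := by exact_mod_cast h4
    simp [L, h5]
  refine le_antisymm ((Finset.card_le_card hRL).trans hL) ?_
  by_contra hcon
  push Not at hcon
  set ε : ℝ := (3 * h + 1) / ρ with hε
  have hε0 : 0 ≤ ε := by positivity
  have hdL : ∀ w, w ∉ L → (d w : ℝ) ≤ 3 * h + 1 := by
    intro w hw
    have : d w ≤ 3 * h + 1 := by
      simp only [L, Finset.mem_filter, Finset.mem_univ, true_and] at hw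
      omega
    exact_mod_cast this
  have hxL : ∀ w, w ∉ L → x w ≤ ε * x z := by
    intro w hw
    rw [hε, div_mul_eq_mul_div, le_div_iff₀ hρpos]
    have h1 := hdx w
    have h2 := mul_le_mul_of_nonneg_right (hdL w hw) hxz.le
    linarith
  have step1 : ∀ u, ρ * x u ≤ ∑ w ∈ L, x w + ε * x z * d u := by
    intro u
    rw [heq, ← hd, Finset.mul_sum, ← Finset.sum_filter_add_sum_filter_not Finset.univ (· ∈ L)
      (fun w => adjMat G u w * x w)]
    apply add_le_add
    · rw [Finset.filter_mem_eq_inter, Finset.univ_inter]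
      apply Finset.sum_le_sum
      intro w _
      exact mul_le_of_le_one_left (hxpos w).le (ha1 u w)
    · refine le_trans (Finset.sum_le_sum (g := fun w => ε * x z * adjMat G u w) ?_)
        (Finset.sum_le_sum_of_subset_of_nonneg (Finset.filter_subset _ _) ?_)
      · intro w hw
        rw [mul_comm]
        exact mul_le_mul_of_nonneg_right (hxL w (Finset.mem_filter.1 hw).2) (ha0 u w)
      · intro w _ _
        exact mul_nonneg (mul_nonneg hε0 hxz.le) (ha0 u w)
  have hdn : ∀ u, (d u : ℝ) ≤ n := by
    intro u
    have := Finset.card_le_univ (Finset.univ.filter (G.Adj u))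
    rw [Fintype.card_fin] at this
    exact_mod_cast this
  have hsumd : ∑ u, (d u : ℝ) ≤ n * (4 * h + 1) := by
    have h1 : ∀ u ∈ Finset.univ, (d u : ℝ) ≤ (if u ∈ L then (n : ℝ) else 0) + (3 * h + 1) := by
      intro u _
      split_ifs with hu
      · have := hdn u
        linarith
      · have := hdL u hu
        linarith
    refine (Finset.sum_le_sum h1).trans ?_
    rw [Finset.sum_add_distrib, ← Finset.sum_filter, Finset.filter_mem_eq_inter,
      Finset.univ_inter, Finset.sum_const, Finset.sum_const, Finset.card_univ, Fintype.card_fin,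
      nsmul_eq_mul, nsmul_eq_mul]
    have : (L.card : ℝ) ≤ h := by exact_mod_cast hL
    nlinarith
  have step2 : ρ ^ 2 * x z ≤ n * ∑ w ∈ L, x w + ε * x z * (n * (4 * h + 1)) := by
    calc ρ ^ 2 * x z = ρ * (ρ * x z) := by ring
      _ = ∑ u, adjMat G z u * (ρ * x u) := by
        rw [heq z, Finset.mul_sum]
        exact Finset.sum_congr rfl fun u _ => by ring
      _ ≤ ∑ u, (∑ w ∈ L, x w + ε * x z * d u) := by
        apply Finset.sum_le_sum
        intro u _
        exact (mul_le_of_le_one_left (mul_nonneg hρ0 (hxpos u).le) (ha1 z u)).trans (step1 u)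
      _ = n * ∑ w ∈ L, x w + ε * x z * ∑ u, (d u : ℝ) := by
        rw [Finset.sum_add_distrib, Finset.sum_const, Finset.card_univ, Fintype.card_fin,
          nsmul_eq_mul, ← Finset.mul_sum]
      _ ≤ _ := by
        have := mul_le_mul_of_nonneg_left hsumd (mul_nonneg hε0 hxz.le)
        linarith
  have hsumL : ∑ w ∈ L, x w ≤ (h - 3 / 4) * x z := by
    rw [← Finset.sum_sdiff hRL]
    have h1 : ∑ w ∈ L \ R, x w ≤ (L \ R).card • (x z / 4) := by
      apply Finset.sum_le_card_nsmul
      intro w hw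
      have hw' : x w < x z / (2 * ((h : ℝ) + 1)) := by
        have := (Finset.mem_sdiff.1 hw).2
        simpa [R] using this
      refine hw'.le.trans ?_
      apply div_le_div_of_nonneg_left hxz.le (by norm_num)
      linarith
    have h2 : ∑ w ∈ R, x w ≤ R.card • x z := Finset.sum_le_card_nsmul _ _ _ fun w _ => hz w
    rw [nsmul_eq_mul] at h1 h2
    have h3 : ((L \ R).card : ℝ) + R.card ≤ h := by
      have := Finset.card_sdiff_add_card_eq_card hRL
      have h4 : (L \ R).card + R.card ≤ h := by omega
      exact_mod_cast h4
    have h5 : (R.card : ℝ) ≤ h - 1 := by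
      have : R.card + 1 ≤ h := hcon
      have : (R.card : ℝ) + 1 ≤ h := by exact_mod_cast this
      linarith
    have h6 : ((L \ R).card : ℝ) / 4 + R.card ≤ h - 3 / 4 := by linarith
    have := mul_le_mul_of_nonneg_right h6 hxz.le
    linarith
  have hεb : ε * (4 * h + 1) ≤ 12 / 100 := by
    rw [hε, div_mul_eq_mul_div, div_le_iff₀ hρpos]
    nlinarith
  have step3 : ρ ^ 2 ≤ n * (h - 3 / 4) + n * (12 / 100) := by
    have h1 := mul_le_mul_of_nonneg_left hsumL hn0.le
    have h2 := mul_le_mul_of_nonneg_left hεb (mul_nonneg hn0.le hxz.le)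
    have : ρ ^ 2 * x z ≤ (n * (h - 3 / 4) + n * (12 / 100)) * x z := by linarith
    exact le_of_mul_le_mul_right this hxz
  nlinarith
end
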